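/- Let k be a number field and let δ be a non-zero element of k that is not a root of unity. Let S be a finite set of non-zero prime ideals of the ring of integers O_k. Then there exists a positive integer n with the following property: for each integer m ≥ n, there exists a non-zero prime ideal 𝔭 of O_k lying outside S such that δ lies in the valuation ring of the 𝔭-adic completion of k (equivalently, the 𝔭-adic valuation of δ is non-negative) and the multiplicative order of the image of δ in the residue class field O_k/𝔭 is equal to m. -/

import Mathlib

set_option synthInstance.maxHeartbeats 400000
set_option maxHeartbeats 800000

open NumberField

/-- `ResidueImage 𝔭 δ c` says that `δ ∈ k` lies in the valuation ring at `𝔭`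
(i.e. `δ = a/b` with `a, b ∈ 𝓞 k`, `b ∉ 𝔭`, equivalently the `𝔭`-adic valuation
of `δ` is non-negative) and that `c` is the image of `δ` in the residue class
field `𝓞 k ⧸ 𝔭`. -/
def ResidueImage {k : Type} [Field k] [NumberField k] (𝔭 : Ideal (𝓞 k)) (δ : k)
    (c : (𝓞 k) ⧸ 𝔭) : Prop :=
  ∃ a b : 𝓞 k, b ∉ 𝔭 ∧ δ * algebraMap (𝓞 k) k b = algebraMap (𝓞 k) k a ∧
    Ideal.Quotient.mk 𝔭 a = c * Ideal.Quotient.mk 𝔭 b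

theorem exists_eq_prod_sub_mul {F : ℂ → ℂ} (hF : Differentiable ℂ F) (Z : Finset ℂ)
    (hZ : ∀ z ∈ Z, F z = 0) :
    ∃ g : ℂ → ℂ, Differentiable ℂ g ∧ ∀ z, F z = (∏ w ∈ Z, (z - w)) * g z := by
  classical
  induction Z using Finset.induction_on with
  | empty => exact ⟨F, hF, by simp⟩
  | insert a s ha ih =>
    obtain ⟨g, hg, hFg⟩ := ih fun z hz => hZ z (Finset.mem_insert_of_mem hz)
    have hga : g a = 0 := by
      have h := hZ a (Finset.mem_insert_self a s)
      rw [hFg a] at h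
      refine (mul_eq_zero.1 h).resolve_left (Finset.prod_ne_zero_iff.2 fun w hw => ?_)
      rintro h0
      exact ha (by rwa [sub_eq_zero.1 h0])
    refine ⟨dslope g a, ?_, fun z => ?_⟩
    · rw [← differentiableOn_univ, Complex.differentiableOn_dslope Filter.univ_mem]
      exact hg.differentiableOn
    · have h := sub_smul_dslope g a z
      rw [hga, sub_zero, smul_eq_mul] at h
      rw [Finset.prod_insert ha, hFg z, ← h]
      ring

theorem norm_le_of_zeros {F : ℂ → ℂ} (hF : Differentiable ℂ F) (Z : Finset ℂ)
    (hZ : ∀ z ∈ Z, F z = 0) {ρ B : ℝ} (hρ : 0 < ρ) (hZρ : ∀ z ∈ Z, ‖z‖ ≤ ρ)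
    (hB : ∀ z, ‖z‖ = 7 * ρ → ‖F z‖ ≤ B) {z : ℂ} (hz : ‖z‖ ≤ ρ) :
    ‖F z‖ ≤ B * (1 / 3) ^ Z.card := by
  obtain ⟨g, hg, hFg⟩ := exists_eq_prod_sub_mul hF Z hZ
  have hgB : ‖g z‖ ≤ B / (6 * ρ) ^ Z.card := by
    refine Complex.norm_le_of_forall_mem_frontier_norm_le (U := Metric.ball 0 (7 * ρ))
      Metric.isBounded_ball hg.diffContOnCl (fun w hw => ?_)
      (subset_closure (by simp; linarith))
    rw [frontier_ball _ (by positivity)] at hw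
    have hw' : ‖w‖ = 7 * ρ := by simpa using hw
    have h1 := hB w hw'
    rw [hFg w, norm_mul, norm_prod] at h1
    have h2 : (6 * ρ) ^ Z.card ≤ ∏ v ∈ Z, ‖w - v‖ := by
      rw [← Finset.prod_const]
      refine Finset.prod_le_prod (fun _ _ => by positivity) fun v hv => ?_
      have := norm_sub_norm_le w v
      have := hZρ v hv
      linarith
    rw [le_div_iff₀ (by positivity)]
    calc ‖g w‖ * (6 * ρ) ^ Z.card ≤ ‖g w‖ * ∏ v ∈ Z, ‖w - v‖ := by gcongr
      _ ≤ B := by rw [mul_comm]; exact h1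
  have h2 : ∏ v ∈ Z, ‖z - v‖ ≤ (2 * ρ) ^ Z.card := by
    rw [← Finset.prod_const]
    refine Finset.prod_le_prod (fun _ _ => by positivity) fun v hv => ?_
    have := norm_sub_le z v
    have := hZρ v hv
    linarith
  rw [hFg z, norm_mul, norm_prod]
  calc _ ≤ (2 * ρ) ^ Z.card * (B / (6 * ρ) ^ Z.card) := by gcongr
    _ = B * (2 * ρ / (6 * ρ)) ^ Z.card := by rw [div_pow]; ring
    _ = _ := by congr 2; field_simp; norm_num

theorem norm_le_of_approx_zeros {F : ℂ → ℂ} (hF : Differentiable ℂ F) (Z : Finset ℂ)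
    {ρ B d ε : ℝ} (hρ : 1 ≤ ρ) (hd : 0 < d) (hd1 : d ≤ 1) (hε : 0 ≤ ε)
    (hZ : ∀ z ∈ Z, ‖F z‖ ≤ ε)
    (hZd : ∀ z ∈ Z, ∀ w ∈ Z, z ≠ w → d ≤ ‖z - w‖) (hZρ : ∀ z ∈ Z, ‖z‖ ≤ ρ)
    (hB : ∀ z, ‖z‖ = 7 * ρ → ‖F z‖ ≤ B) {z : ℂ} (hz : ‖z‖ ≤ ρ) :
    ‖F z‖ ≤ B * (1 / 3) ^ Z.card + 2 * (Z.card * (ε * (8 * ρ / d) ^ Z.card)) := by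
  set P := Lagrange.interpolate Z id F with hP
  have hPb : ∀ w : ℂ, ‖w‖ ≤ 7 * ρ → ‖P.eval w‖ ≤ Z.card * (ε * (8 * ρ / d) ^ Z.card) := by
    intro w hw
    rw [hP, Lagrange.interpolate_apply, Polynomial.eval_finsetSum]
    refine (norm_sum_le _ _).trans ?_
    rw [← nsmul_eq_mul]
    refine Finset.sum_le_card_nsmul _ _ _ fun v hv => ?_
    rw [Polynomial.eval_mul, Polynomial.eval_C, norm_mul]
    gcongr
    · exact hZ v hv
    rw [Lagrange.basis, Polynomial.eval_prod, norm_prod]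
    calc ∏ u ∈ Z.erase v, ‖Polynomial.eval w (Lagrange.basisDivisor (id v) (id u))‖
        ≤ ∏ u ∈ Z.erase v, (8 * ρ / d) := by
          refine Finset.prod_le_prod (fun _ _ => norm_nonneg _) fun u hu => ?_
          have h1 := hZd v hv u (Finset.mem_of_mem_erase hu) (Finset.ne_of_mem_erase hu).symm
          have h2 := norm_sub_le w u
          have h3 := hZρ u (Finset.mem_of_mem_erase hu)
          simp only [Lagrange.basisDivisor, id, Polynomial.eval_mul, Polynomial.eval_C,
            Polynomial.eval_sub, Polynomial.eval_X, norm_mul, norm_inv]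
          rw [inv_mul_eq_div]
          gcongr
          linarith
      _ ≤ (8 * ρ / d) ^ Z.card := by
          rw [Finset.prod_const]
          refine pow_le_pow_right₀ ?_ (Finset.card_le_card (Finset.erase_subset _ _))
          rw [le_div_iff₀ hd]; linarith
  set E := (Z.card : ℝ) * (ε * (8 * ρ / d) ^ Z.card) with hE
  have hE0 : 0 ≤ E := by positivity
  have key := norm_le_of_zeros (F := fun w => F w - P.eval w) (hF.sub P.differentiable) Z
    (fun w hw => by
      have := Lagrange.eval_interpolate_at_node (s := Z) (v := id) F (fun _ _ _ _ h => h) hw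
      simp only [id] at this
      rw [hP, this, sub_self]) (by linarith) hZρ (B := B + E)
    (fun w hw => (norm_sub_le _ _).trans (add_le_add (hB w hw) (hPb w hw.le))) hz
  have h1 : ‖F z‖ ≤ ‖F z - P.eval z‖ + ‖P.eval z‖ := by
    simpa using norm_add_le (F z - P.eval z) (P.eval z)
  have h2 := hPb z (by linarith)
  have h3 : E * (1 / 3) ^ Z.card ≤ E * 1 := by
    gcongr
    exact pow_le_one₀ (by norm_num) (by norm_num)
  rw [add_mul] at key
  linarith

theorem house_le_of_forall_norm_le {k : Type*} [Field k] [NumberField k] {x : k} {B : ℝ}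
    (hB : 0 ≤ B) (h : ∀ τ : k →+* ℂ, ‖τ x‖ ≤ B) : house x ≤ B := by
  rw [house, pi_norm_le_iff_of_nonneg hB]
  exact h

theorem one_le_norm_mul_house_pow {k : Type*} [Field k] [NumberField k] (σ : k →+* ℂ)
    {x : 𝓞 k} (hx : x ≠ 0) :
    1 ≤ ‖σ x‖ * house (x : k) ^ (Module.finrank ℚ k - 1) := by
  refine le_trans ?_ (norm_norm_le_norm_mul_house_pow (x : k) σ)
  have h : Algebra.norm ℤ x ≠ 0 := Algebra.norm_ne_zero_iff.2 hx
  rw [← Algebra.coe_norm_int, ← Rat.norm_cast_real]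
  simp only [Rat.cast_intCast, Int.norm_cast_real]
  rw [Int.norm_eq_abs]
  exact_mod_cast Int.one_le_abs h

/-- The value at `(r, s)` of the auxiliary exponential polynomial with coefficients `ξ`. -/
noncomputable def auxValue {k : Type*} [Field k] [NumberField k] {L₀ L₁ : ℕ} (δ : k)
    (ξ : Fin L₀ × Fin L₁ → 𝓞 k) (a : ℤ) (m r s : ℕ) : k :=
  ∑ x, (ξ x : k) * (((a * r + m * s) ^ (x.1 : ℕ) * a ^ (L₀ - x.1)) * δ ^ (x.2 * r : ℕ))

/-- The auxiliary exponential polynomial as an entire function. -/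
noncomputable def auxFun {L₀ L₁ : ℕ} (p : Fin L₀ × Fin L₁ → ℂ) (a : ℤ) (θ : ℝ) (z : ℂ) : ℂ :=
  ∑ x, p x * ((a ^ L₀ * z ^ (x.1 : ℕ)) * Complex.exp ((x.2 : ℕ) * (θ * Complex.I) * z))

/-- The integral coefficient of `ξ x` in a multiple of `auxValue`. -/
noncomputable def auxCoeff {k : Type*} [Field k] [NumberField k] {L₀ L₁ : ℕ} (η : 𝓞 k) (q : ℕ)
    (a : ℤ) (m N r s : ℕ) (x : Fin L₀ × Fin L₁) : 𝓞 k :=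
  ((a * r + m * s) ^ (x.1 : ℕ) * a ^ (L₀ - x.1)) * (η ^ (x.2 * r : ℕ) * q ^ (L₁ * N - x.2 * r))

theorem differentiable_auxFun {L₀ L₁ : ℕ} (p : Fin L₀ × Fin L₁ → ℂ) (a : ℤ) (θ : ℝ) :
    Differentiable ℂ (auxFun p a θ) := by
  unfold auxFun
  fun_prop

theorem norm_auxFun_le {L₀ L₁ : ℕ} {p : Fin L₀ × Fin L₁ → ℂ} {a : ℤ} {θ : ℝ} {z : ℂ}
    {X R m : ℝ} (hp : ∀ x, ‖p x‖ ≤ X) (ham : |(a : ℝ)| ≤ m) (hθ : |θ| ≤ 4)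
    (hR : 1 ≤ R) (hz : ‖z‖ ≤ R) :
    ‖auxFun p a θ z‖ ≤ (L₀ * L₁ : ℕ) * (X * ((m * R) ^ L₀ * Real.exp (4 * L₁ * R))) := by
  unfold auxFun
  refine (norm_sum_le _ _).trans ?_
  have hc : (L₀ * L₁ : ℕ) = (Finset.univ : Finset (Fin L₀ × Fin L₁)).card := by simp
  rw [hc]
  refine le_of_le_of_eq ?_ (nsmul_eq_mul _ _)
  refine Finset.sum_le_card_nsmul _ _ _ fun x _ => ?_
  have hm : 0 ≤ m := (abs_nonneg _).trans ham
  have hX : 0 ≤ X := (norm_nonneg _).trans (hp x)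
  rw [norm_mul, norm_mul, norm_mul, norm_pow, norm_pow, Complex.norm_intCast, mul_pow]
  gcongr
  · exact hp x
  · calc ‖z‖ ^ (x.1 : ℕ) ≤ R ^ (x.1 : ℕ) := by gcongr
      _ ≤ R ^ L₀ := pow_le_pow_right₀ hR x.1.2.le
  · refine (Complex.norm_exp_le_exp_norm _).trans (Real.exp_le_exp.2 ?_)
    simp only [norm_mul, Complex.norm_natCast, Complex.norm_real, Complex.norm_I, mul_one,
      Real.norm_eq_abs]
    have h1 : ((x.2 : ℕ) : ℝ) ≤ L₁ := by exact_mod_cast x.2.2.le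
    calc ((x.2 : ℕ) : ℝ) * |θ| * ‖z‖ ≤ L₁ * 4 * R := by gcongr
      _ = _ := by ring

theorem abs_lin_le {a : ℤ} {m N r s : ℕ} (ham : |(a : ℝ)| ≤ m) (hr : r < N) (hs : s < N) :
    |(a : ℝ) * r + m * s| ≤ 2 * m * N := by
  have hr' : (r : ℝ) ≤ N := by exact_mod_cast hr.le
  have hs' : (s : ℝ) ≤ N := by exact_mod_cast hs.le
  calc |(a : ℝ) * r + m * s| ≤ |(a : ℝ) * r| + |(m : ℝ) * s| := abs_add_le _ _
    _ = |(a : ℝ)| * r + m * s := by simp [abs_mul]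
    _ ≤ m * N + m * N := by gcongr
    _ = _ := by ring

theorem norm_polyPart_le {L₀ : ℕ} {a : ℤ} {m N r s i : ℕ} (hi : i < L₀) (hm : 1 ≤ m)
    (ham : |(a : ℝ)| ≤ m) (hr : r < N) (hs : s < N) :
    ‖((a * r + m * s) ^ i * a ^ (L₀ - i) : ℂ)‖ ≤ (2 * m * N) ^ L₀ * (m : ℝ) ^ L₀ := by
  have h1 : ‖((a : ℂ) * r + m * s)‖ ≤ 2 * m * N := by
    have : ((a : ℂ) * r + m * s) = (((a : ℝ) * r + m * s : ℝ) : ℂ) := by push_cast; rfl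
    rw [this, Complex.norm_real]
    exact abs_lin_le ham hr hs
  have hm' : (1 : ℝ) ≤ m := by exact_mod_cast hm
  have hN : (1 : ℝ) ≤ N := by exact_mod_cast (show 1 ≤ N by omega)
  rw [norm_mul, norm_pow, norm_pow, Complex.norm_intCast]
  gcongr
  · exact (pow_le_pow_left₀ (norm_nonneg _) h1 _).trans
      (pow_le_pow_right₀ (by nlinarith) hi.le)
  · exact (pow_le_pow_left₀ (abs_nonneg _) ham _).trans
      (pow_le_pow_right₀ hm' (by omega))

theorem norm_map_auxValue_sub_auxFun_le {k : Type*} [Field k] [NumberField k] {L₀ L₁ : ℕ}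
    {σ : k →+* ℂ} {δ : k} {θ : ℝ} (hσ : σ δ = Complex.exp (θ * Complex.I))
    {ξ : Fin L₀ × Fin L₁ → 𝓞 k} {a : ℤ} {m N r s : ℕ} (hm : 1 ≤ m) (ha : a ≠ 0)
    (ham : |(a : ℝ)| ≤ m) (hr : r < N) (hs : s < N) {X Λ : ℝ} (hX : ∀ x, ‖σ (ξ x)‖ ≤ X)
    (hΛ : |m * θ - 2 * Real.pi * a| ≤ Λ) :
    ‖σ (auxValue δ ξ a m r s) - auxFun (fun x => σ (ξ x)) a θ (r + s * m / a)‖ ≤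
      (L₀ * L₁ : ℕ) * (X * (((2 * m * N) ^ L₀ * (m : ℝ) ^ L₀) * (L₁ * N * Λ))) := by
  unfold auxValue auxFun
  rw [map_sum, ← Finset.sum_sub_distrib]
  refine (norm_sum_le _ _).trans ?_
  have hc : (L₀ * L₁ : ℕ) = (Finset.univ : Finset (Fin L₀ × Fin L₁)).card := by simp
  rw [hc]
  refine le_of_le_of_eq ?_ (nsmul_eq_mul _ _)
  refine Finset.sum_le_card_nsmul _ _ _ fun x _ => ?_
  have haC : (a : ℂ) ≠ 0 := by exact_mod_cast ha
  have haR : (a : ℝ) ≠ 0 := by exact_mod_cast ha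
  have hX0 : 0 ≤ X := (norm_nonneg _).trans (hX x)
  obtain ⟨⟨i, hi⟩, ⟨j, hj⟩⟩ := x
  simp only
  set y : ℝ := j * s * ((m * θ - 2 * Real.pi * a) / a) with hy
  have hpow : (a : ℂ) ^ L₀ * (r + s * m / a) ^ i = (a * r + m * s) ^ i * a ^ (L₀ - i) := by
    have h1 : (a : ℂ) * r + m * s = a * (r + s * m / a) := by field_simp
    rw [h1, mul_pow, show L₀ = i + (L₀ - i) by omega, pow_add,
      show i + (L₀ - i) - i = L₀ - i by omega]
    ring
  have hexp : Complex.exp ((j : ℕ) * (θ * Complex.I) * (r + s * m / a)) =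
      σ δ ^ (j * r) * Complex.exp (Complex.I * y) := by
    rw [hσ, ← Complex.exp_nat_mul, ← Complex.exp_add]
    rw [Complex.exp_eq_exp_iff_exists_int]
    refine ⟨j * s, ?_⟩
    rw [hy]
    push_cast
    field_simp
    ring
  have hδ1 : ‖σ δ‖ = 1 := by rw [hσ, Complex.norm_exp_ofReal_mul_I]
  have key : σ ((ξ (⟨i, hi⟩, ⟨j, hj⟩) : k) *
        (((a * r + m * s) ^ i * a ^ (L₀ - i)) * δ ^ (j * r))) -
      σ (ξ (⟨i, hi⟩, ⟨j, hj⟩)) * (((a : ℂ) ^ L₀ * (r + s * m / a) ^ i) *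
        Complex.exp ((j : ℕ) * (θ * Complex.I) * (r + s * m / a))) =
      -(σ (ξ (⟨i, hi⟩, ⟨j, hj⟩)) * (((a * r + m * s) ^ i * a ^ (L₀ - i)) *
        (σ δ ^ (j * r) * (Complex.exp (Complex.I * y) - 1)))) := by
    rw [hpow, hexp]
    simp only [map_mul, map_pow, map_add, map_intCast, map_natCast]
    ring
  have hnorm : ‖σ δ ^ (j * r) * (Complex.exp (Complex.I * y) - 1)‖ =
      ‖Complex.exp (Complex.I * y) - 1‖ := by
    rw [norm_mul, norm_pow, hδ1, one_pow, one_mul]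
  rw [key, norm_neg, norm_mul, norm_mul, hnorm]
  gcongr
  · exact hX _
  · exact norm_polyPart_le hi hm ham hr hs
  · refine (Real.norm_exp_I_mul_ofReal_sub_one_le).trans ?_
    rw [hy, Real.norm_eq_abs, abs_mul, abs_mul, abs_div, Nat.abs_cast, Nat.abs_cast]
    have h1 : (1 : ℝ) ≤ |(a : ℝ)| := by exact_mod_cast Int.one_le_abs ha
    have h2 : |m * θ - 2 * Real.pi * a| / |(a : ℝ)| ≤ Λ :=
      (div_le_self (abs_nonneg _) h1).trans hΛ
    have h3 : (j : ℝ) ≤ L₁ := by exact_mod_cast hj.le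
    have h4 : (s : ℝ) ≤ N := by exact_mod_cast hs.le
    gcongr

theorem norm_map_auxCoeff_le {k : Type*} [Field k] [NumberField k] {L₀ L₁ : ℕ} {η : 𝓞 k} {q : ℕ}
    {Q : ℝ} (hq : (q : ℝ) ≤ Q) (hQ : 1 ≤ Q) (hη : ∀ τ : k →+* ℂ, ‖τ η‖ ≤ Q)
    {a : ℤ} {m N r s : ℕ} (hm : 1 ≤ m) (ham : |(a : ℝ)| ≤ m) (hr : r < N) (hs : s < N)
    (x : Fin L₀ × Fin L₁) (τ : k →+* ℂ) :
    ‖τ (auxCoeff η q a m N r s x)‖ ≤ ((2 * m * N) ^ L₀ * (m : ℝ) ^ L₀) * Q ^ (L₁ * N) := by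
  have hjr : (x.2 : ℕ) * r ≤ L₁ * N := Nat.mul_le_mul x.2.2.le hr.le
  have h1 := norm_polyPart_le x.1.2 hm ham hr hs
  have h2 : ‖(τ η) ^ ((x.2 : ℕ) * r) * (q : ℂ) ^ (L₁ * N - x.2 * r)‖ ≤ Q ^ (L₁ * N) := by
    rw [norm_mul, norm_pow, norm_pow, Complex.norm_natCast]
    calc _ ≤ Q ^ ((x.2 : ℕ) * r) * Q ^ (L₁ * N - x.2 * r) := by
          gcongr
          exact hη τ
      _ = _ := by rw [← pow_add]; congr 1; omega
  have h3 : τ (auxCoeff η q a m N r s x) = ((a * r + m * s) ^ (x.1 : ℕ) * a ^ (L₀ - x.1)) *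
      ((τ η) ^ ((x.2 : ℕ) * r) * (q : ℂ) ^ (L₁ * N - x.2 * r)) := by
    simp [auxCoeff]
  rw [h3, norm_mul]
  gcongr

theorem sum_auxCoeff_mul {k : Type*} [Field k] [NumberField k] {L₀ L₁ : ℕ} {η : 𝓞 k} {q : ℕ}
    {δ : k} (hη : (η : k) = q * δ) {a : ℤ} {m N r s : ℕ} (hr : r ≤ N)
    (ξ : Fin L₀ × Fin L₁ → 𝓞 k) :
    ((∑ x, auxCoeff η q a m N r s x * ξ x : 𝓞 k) : k) =
      q ^ (L₁ * N) * auxValue δ ξ a m r s := by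
  unfold auxValue auxCoeff
  change algebraMap (𝓞 k) k _ = _
  rw [map_sum, Finset.mul_sum]
  refine Finset.sum_congr rfl fun x _ => ?_
  have hjr : (x.2 : ℕ) * r ≤ L₁ * N := Nat.mul_le_mul x.2.2.le hr
  have hq : (q : k) ^ (L₁ * N) = q ^ ((x.2 : ℕ) * r) * q ^ (L₁ * N - x.2 * r) := by
    rw [← pow_add]; congr 1; omega
  rw [hq]
  simp only [map_mul, map_pow, map_add, map_intCast, map_natCast, hη, mul_pow]
  ring

theorem polyPart_le_exp {U m N : ℕ} (hU : 4 * (U : ℝ) ^ 6 ≤ Real.exp U)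
    (hm : (m : ℝ) ≤ Real.exp U) (hN : N ≤ 2 * U ^ 6) :
    (2 * m * N : ℝ) ^ (2 * U ^ 6) * (m : ℝ) ^ (2 * U ^ 6) ≤ Real.exp (6 * (U : ℝ) ^ 7) := by
  have hN' : (N : ℝ) ≤ 2 * U ^ 6 := by exact_mod_cast hN
  have h1 : (2 * m * N : ℝ) ≤ Real.exp (2 * U) := by
    calc (2 * m * N : ℝ) = m * (2 * N) := by ring
      _ ≤ Real.exp U * Real.exp U := by
          gcongr
          linarith
      _ = _ := by rw [← Real.exp_add]; congr 1; ring
  calc _ ≤ Real.exp (2 * U) ^ (2 * U ^ 6) * Real.exp U ^ (2 * U ^ 6) := by gcongr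
    _ = _ := by
      rw [← Real.exp_nat_mul, ← Real.exp_nat_mul, ← Real.exp_add]
      congr 1
      push_cast
      ring

theorem house_scaled_auxValue_le {k : Type*} [Field k] [NumberField k]
    {η : 𝓞 k} {q : ℕ} {c : ℝ} (hc : 0 ≤ c) (hq : (q : ℝ) ≤ Real.exp c)
    (hη : ∀ τ : k →+* ℂ, ‖τ η‖ ≤ Real.exp c)
    {U : ℕ} (hU : 4 * (U : ℝ) ^ 8 ≤ Real.exp U) (hU1 : 1 ≤ U)
    {m N r s : ℕ} {a : ℤ} (hm : 1 ≤ m) (hmU : (m : ℝ) ≤ Real.exp U) (ham : |(a : ℝ)| ≤ m)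
    {ξ : Fin (2 * U ^ 6) × Fin (U ^ 2) → 𝓞 k}
    (hξ : ∀ (τ : k →+* ℂ) x, ‖τ (ξ x)‖ ≤ Real.exp (7 * (U : ℝ) ^ 7))
    (hN : N ≤ 2 * U ^ 6) (hr : r < N) (hs : s < N) :
    house ((∑ x, auxCoeff η q a m N r s x * ξ x : 𝓞 k) : k) ≤
      Real.exp (14 * (U : ℝ) ^ 7 + c * (U : ℝ) ^ 2 * N) := by
  have hU1' : (1 : ℝ) ≤ U := by exact_mod_cast hU1
  refine house_le_of_forall_norm_le (Real.exp_nonneg _) fun τ => ?_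
  have h1 : τ ((∑ x, auxCoeff η q a m N r s x * ξ x : 𝓞 k) : k) =
      ∑ x, τ (auxCoeff η q a m N r s x) * τ (ξ x) := by
    change τ (algebraMap (𝓞 k) k _) = _
    simp only [map_sum, map_mul]
  rw [h1]
  refine (norm_sum_le _ _).trans ?_
  have hbound : ∀ x ∈ (Finset.univ : Finset (Fin (2 * U ^ 6) × Fin (U ^ 2))),
      ‖τ (auxCoeff η q a m N r s x) * τ (ξ x)‖ ≤
        (Real.exp (6 * (U : ℝ) ^ 7) * Real.exp c ^ (U ^ 2 * N)) * Real.exp (7 * (U : ℝ) ^ 7) := by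
    intro x _
    rw [norm_mul]
    gcongr
    · refine (norm_map_auxCoeff_le hq (Real.one_le_exp hc) hη hm ham hr hs x τ).trans ?_
      gcongr
      refine polyPart_le_exp (le_trans ?_ hU) hmU hN
      gcongr
      norm_num
    · exact hξ τ x
  refine (Finset.sum_le_card_nsmul _ _ _ hbound).trans ?_
  rw [nsmul_eq_mul]
  have hcard : ((Finset.univ : Finset (Fin (2 * U ^ 6) × Fin (U ^ 2))).card : ℝ) ≤
      Real.exp (U : ℝ) := by
    rw [Finset.card_univ, Fintype.card_prod, Fintype.card_fin, Fintype.card_fin]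
    refine le_trans ?_ hU
    push_cast
    rw [mul_assoc, ← pow_add]
    norm_num
    gcongr
    norm_num
  calc _ ≤ Real.exp (U : ℝ) * ((Real.exp (6 * (U : ℝ) ^ 7) * Real.exp c ^ (U ^ 2 * N)) *
        Real.exp (7 * (U : ℝ) ^ 7)) := by gcongr
    _ ≤ _ := by
      rw [← Real.exp_nat_mul, ← Real.exp_add, ← Real.exp_add, ← Real.exp_add]
      refine Real.exp_le_exp.2 ?_
      have : (U : ℝ) ≤ U ^ 7 := le_self_pow₀ hU1' (by norm_num)
      push_cast
      linarith

theorem norm_auxFun_le_exp {U : ℕ} {β : ℝ} (hβ : 0 ≤ β) (hU1 : 1 ≤ U)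
    (hU : 100 * (1 + β) * (U : ℝ) ^ 20 ≤ Real.exp U)
    {m N N' : ℕ} {a : ℤ} {θ : ℝ} (hθ : |θ| ≤ 4) (hmU : (m : ℝ) ≤ Real.exp U)
    (ha : a ≠ 0) (ham : |(a : ℝ)| ≤ m) (hβa : (m : ℝ) ≤ β * |(a : ℝ)|)
    {p : Fin (2 * U ^ 6) × Fin (U ^ 2) → ℂ} (hp : ∀ x, ‖p x‖ ≤ Real.exp (7 * (U : ℝ) ^ 7))
    (hN1 : 1 ≤ N) (hN : N ≤ U ^ 5) (hNN' : N ≤ N') (hN' : N' ≤ 2 * U ^ 6)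
    (hinj : ∀ r < N, ∀ s < N, ∀ r' < N, ∀ s' < N,
      a * r + m * s = a * r' + m * s' → r = r' ∧ s = s')
    (hsmall : ∀ r < N, ∀ s < N, ‖auxFun p a θ (r + s * m / a)‖ ≤
      Real.exp (15 * (U : ℝ) ^ 7 - (U : ℝ) ^ 12))
    {r s : ℕ} (hr : r < N') (hs : s < N') :
    ‖auxFun p a θ (r + s * m / a)‖ ≤
      Real.exp (12 * (U : ℝ) ^ 7 + 28 * (1 + β) * (U : ℝ) ^ 2 * N' - (N : ℝ) ^ 2) +
      Real.exp (19 * (U : ℝ) ^ 11 - (U : ℝ) ^ 12) := by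
  have hU1' : (1 : ℝ) ≤ U := by exact_mod_cast hU1
  have haC : (a : ℂ) ≠ 0 := by exact_mod_cast ha
  have haR : 1 ≤ |(a : ℝ)| := by exact_mod_cast Int.one_le_abs ha
  have hUpow : ∀ {i j : ℕ}, i ≤ j → (U : ℝ) ^ i ≤ (U : ℝ) ^ j :=
    fun h => pow_le_pow_right₀ hU1' h
  have hNr : (N : ℝ) ≤ U ^ 5 := by exact_mod_cast hN
  have hN'r : (N' : ℝ) ≤ 2 * U ^ 6 := by exact_mod_cast hN'
  have hN'1 : (1 : ℝ) ≤ N' := by exact_mod_cast hN1.trans hNN'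
  set ρ : ℝ := (1 + β) * N' with hρdef
  have hρ : 1 ≤ ρ := by nlinarith
  have hβU : (U : ℝ) ^ 20 ≤ (1 + β) * (U : ℝ) ^ 20 :=
      le_mul_of_one_le_left (by positivity) (by linarith)
  have h8ρ : 8 * ρ ≤ Real.exp U := by
    refine le_trans ?_ hU
    calc 8 * ρ = 8 * (1 + β) * N' := by rw [hρdef]; ring
      _ ≤ 8 * (1 + β) * (2 * U ^ 6) := by gcongr
      _ ≤ 8 * (1 + β) * (2 * U ^ 20) := by gcongr; norm_num
      _ = 16 * ((1 + β) * U ^ 20) := by ring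
      _ ≤ _ := by nlinarith
  have hnorm : ∀ {i j n : ℕ}, i < n → j < n → ‖((i : ℂ) + j * m / a)‖ ≤ (1 + β) * n := by
    intro i j n hi hj
    have hi' : (i : ℝ) ≤ n := by exact_mod_cast hi.le
    have hj' : (j : ℝ) ≤ n := by exact_mod_cast hj.le
    have h1 : (m : ℝ) / |(a : ℝ)| ≤ β := by rwa [div_le_iff₀ (by linarith)]
    calc ‖((i : ℂ) + j * m / a)‖ ≤ ‖(i : ℂ)‖ + ‖(j * m / a : ℂ)‖ := norm_add_le _ _
      _ = i + j * (m / |(a : ℝ)|) := by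
          simp only [norm_div, norm_mul, Complex.norm_natCast, Complex.norm_intCast]; ring
      _ ≤ n + n * β := by gcongr
      _ = _ := by ring
  set f : ℕ × ℕ → ℂ := fun x => x.1 + x.2 * m / a with hf
  have hdiff : ∀ x y : ℕ × ℕ, f x - f y =
      ((a * x.1 + m * x.2 - (a * y.1 + m * y.2) : ℤ) : ℂ) / a := by
    intro x y
    rw [hf]
    push_cast
    field_simp
  set Z : Finset ℂ := (Finset.range N ×ˢ Finset.range N).image f with hZ
  have hfinj : Set.InjOn f (Finset.range N ×ˢ Finset.range N : Finset (ℕ × ℕ)) := by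
    rintro ⟨x1, x2⟩ hx ⟨y1, y2⟩ hy hxy
    simp only [Finset.coe_product, Finset.coe_range, Set.mem_prod, Set.mem_Iio] at hx hy
    have h1 := hdiff (x1, x2) (y1, y2)
    rw [hxy, sub_self, eq_comm, div_eq_zero_iff, or_iff_left haC] at h1
    have h2 : (a * x1 + m * x2 - (a * y1 + m * y2) : ℤ) = 0 := by exact_mod_cast h1
    obtain ⟨h3, h4⟩ := hinj x1 hx.1 x2 hx.2 y1 hy.1 y2 hy.2 (by linarith)
    rw [h3, h4]
  have hcard : Z.card = N ^ 2 := by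
    rw [hZ, Finset.card_image_of_injOn hfinj, Finset.card_product, Finset.card_range, sq]
  have hcardU : (Z.card : ℝ) ≤ U ^ 10 := by
    rw [hcard]; push_cast
    calc (N : ℝ) ^ 2 ≤ (U ^ 5) ^ 2 := by gcongr
      _ = _ := by ring
  have hcardE : 2 * (Z.card : ℝ) ≤ Real.exp U := by
    have := hUpow (show 10 ≤ 20 by norm_num)
    nlinarith
  have key := norm_le_of_approx_zeros (differentiable_auxFun p a θ) Z (ρ := ρ)
    (B := Real.exp (12 * (U : ℝ) ^ 7 + 28 * (1 + β) * (U : ℝ) ^ 2 * N'))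
    (d := Real.exp (-U)) (ε := Real.exp (15 * (U : ℝ) ^ 7 - (U : ℝ) ^ 12)) hρ (Real.exp_pos _)
    (Real.exp_le_one_iff.2 (by linarith)) (Real.exp_nonneg _) ?_ ?_ ?_ ?_
    (z := r + s * m / a) (hnorm hr hs)
  · refine key.trans (add_le_add ?_ ?_)
    · rw [sub_eq_add_neg, Real.exp_add _ (-(N : ℝ) ^ 2), hcard]
      gcongr
      have h3 : (1 / 3 : ℝ) ≤ Real.exp (-1) := by
        rw [Real.exp_neg, one_div]
        exact inv_anti₀ (Real.exp_pos _) (by linarith [Real.exp_one_lt_d9])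
      calc (1 / 3 : ℝ) ^ N ^ 2 ≤ Real.exp (-1) ^ N ^ 2 := by gcongr
        _ = _ := by rw [← Real.exp_nat_mul]; congr 1; push_cast; ring
    · have h1 : (8 * ρ / Real.exp (-U)) ^ Z.card ≤ Real.exp (2 * (U : ℝ) ^ 11) := by
        calc (8 * ρ / Real.exp (-U)) ^ Z.card ≤ (Real.exp (2 * U)) ^ Z.card := by
              gcongr
              rw [div_le_iff₀ (Real.exp_pos _), ← Real.exp_add]
              rwa [show 2 * (U : ℝ) + -U = U by ring]
          _ = Real.exp (Z.card * (2 * U)) := by rw [← Real.exp_nat_mul]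
          _ ≤ _ := by
              refine Real.exp_le_exp.2 ?_
              calc (Z.card * (2 * U) : ℝ) ≤ U ^ 10 * (2 * U) := by gcongr
                _ = _ := by ring
      calc 2 * ((Z.card : ℝ) * (Real.exp (15 * (U : ℝ) ^ 7 - (U : ℝ) ^ 12) *
            (8 * ρ / Real.exp (-U)) ^ Z.card))
          = 2 * (Z.card : ℝ) * (Real.exp (15 * (U : ℝ) ^ 7 - (U : ℝ) ^ 12) *
            (8 * ρ / Real.exp (-U)) ^ Z.card) := by ring
        _ ≤ Real.exp U * (Real.exp (15 * (U : ℝ) ^ 7 - (U : ℝ) ^ 12) *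
            Real.exp (2 * (U : ℝ) ^ 11)) := by gcongr
        _ ≤ _ := by
          rw [← Real.exp_add, ← Real.exp_add]
          refine Real.exp_le_exp.2 ?_
          have h2 : (U : ℝ) ≤ U ^ 11 := le_self_pow₀ hU1' (by norm_num)
          have h3 : (U : ℝ) ^ 7 ≤ U ^ 11 := hUpow (by norm_num)
          linarith
  · intro z hz
    obtain ⟨x, hx, rfl⟩ := Finset.mem_image.1 hz
    rw [Finset.mem_product, Finset.mem_range, Finset.mem_range] at hx
    exact hsmall _ hx.1 _ hx.2
  · intro z hz w hw hzw
    obtain ⟨x, hx, rfl⟩ := Finset.mem_image.1 hz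
    obtain ⟨y, hy, rfl⟩ := Finset.mem_image.1 hw
    have h1 := hdiff x y
    have h2 : (a * x.1 + m * x.2 - (a * y.1 + m * y.2) : ℤ) ≠ 0 := by
      intro h0
      rw [h0, Int.cast_zero, zero_div, sub_eq_zero] at h1
      exact hzw h1
    have h3 : (1 : ℝ) ≤ |((a * x.1 + m * x.2 - (a * y.1 + m * y.2) : ℤ) : ℝ)| := by
      exact_mod_cast Int.one_le_abs h2
    rw [h1, norm_div, Complex.norm_intCast, Complex.norm_intCast, Real.exp_neg,
      le_div_iff₀ (by linarith)]
    calc (Real.exp U)⁻¹ * |(a : ℝ)| ≤ (Real.exp U)⁻¹ * Real.exp U := by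
          gcongr; exact ham.trans hmU
      _ = 1 := inv_mul_cancel₀ (Real.exp_pos _).ne'
      _ ≤ _ := h3
  · intro z hz
    obtain ⟨x, hx, rfl⟩ := Finset.mem_image.1 hz
    rw [Finset.mem_product, Finset.mem_range, Finset.mem_range] at hx
    refine (hnorm hx.1 hx.2).trans ?_
    rw [hρdef]
    gcongr
  · intro z hz
    refine (norm_auxFun_le hp (ham.trans hmU) hθ (R := 7 * ρ) (by linarith) hz.le).trans ?_
    have hL : ((2 * U ^ 6 * U ^ 2 : ℕ) : ℝ) ≤ Real.exp U := by
      push_cast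
      have := hUpow (show 8 ≤ 20 by norm_num)
      nlinarith
    calc _ ≤ Real.exp U * (Real.exp (7 * (U : ℝ) ^ 7) *
          ((Real.exp U * Real.exp U) ^ (2 * U ^ 6) *
            Real.exp (4 * ((U ^ 2 : ℕ) : ℝ) * (7 * ρ)))) := by
          gcongr
          linarith
      _ ≤ _ := by
          rw [← Real.exp_add U, ← Real.exp_nat_mul, ← Real.exp_add, ← Real.exp_add, ← Real.exp_add]
          refine Real.exp_le_exp.2 ?_
          have h2 : (U : ℝ) ≤ U ^ 7 := le_self_pow₀ hU1' (by norm_num)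
          rw [hρdef]
          push_cast
          nlinarith

theorem auxValue_eq_zero_of_extrapolation {k : Type*} [Field k] [NumberField k]
    {σ : k →+* ℂ} {δ : k} {θ : ℝ} (hσ : σ δ = Complex.exp (θ * Complex.I)) (hθ : |θ| ≤ 4)
    {η : 𝓞 k} {q : ℕ} {c : ℝ} (hc : 0 ≤ c) (hq0 : q ≠ 0) (hq : (q : ℝ) ≤ Real.exp c)
    (hηδ : (η : k) = q * δ) (hη : ∀ τ : k →+* ℂ, ‖τ η‖ ≤ Real.exp c)
    {U : ℕ} {β : ℝ} (hβ : 0 ≤ β) (hU100 : 100 ≤ U)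
    (hU : 100 * (1 + β) * (U : ℝ) ^ 20 ≤ Real.exp U)
    {m : ℕ} {a : ℤ} (hm : 1 ≤ m) (hmU : (m : ℝ) ≤ Real.exp U)
    (ha : a ≠ 0) (ham : |(a : ℝ)| ≤ m) (hβa : (m : ℝ) ≤ β * |(a : ℝ)|)
    (hΛ : |m * θ - 2 * Real.pi * a| ≤ 2 * Real.exp (-(U : ℝ) ^ 12))
    {ξ : Fin (2 * U ^ 6) × Fin (U ^ 2) → 𝓞 k}
    (hξ : ∀ (τ : k →+* ℂ) x, ‖τ (ξ x)‖ ≤ Real.exp (7 * (U : ℝ) ^ 7))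
    {N N' : ℕ} (hN1 : 1 ≤ N) (hN : N ≤ U ^ 5) (hNN' : N ≤ N') (hN' : N' ≤ 2 * U ^ 6)
    (hinj : ∀ r < N, ∀ s < N, ∀ r' < N, ∀ s' < N,
      a * r + m * s = a * r' + m * s' → r = r' ∧ s = s')
    (hD : Module.finrank ℚ k * (14 * (U : ℝ) ^ 7 + (c + 28 * (1 + β)) * (U : ℝ) ^ 2 * N') <
      (N : ℝ) ^ 2)
    (hV : ∀ r < N, ∀ s < N, auxValue δ ξ a m r s = 0) :
    ∀ r < N', ∀ s < N', auxValue δ ξ a m r s = 0 := by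
  intro r hr s hs
  have hU1 : 1 ≤ U := by omega
  have hU1' : (1 : ℝ) ≤ U := by exact_mod_cast hU1
  have hU100' : (100 : ℝ) ≤ U := by exact_mod_cast hU100
  have hUpow : ∀ {i j : ℕ}, i ≤ j → (U : ℝ) ^ i ≤ (U : ℝ) ^ j :=
    fun h => pow_le_pow_right₀ hU1' h
  have hβU : (U : ℝ) ^ 20 ≤ (1 + β) * (U : ℝ) ^ 20 :=
      le_mul_of_one_le_left (by positivity) (by linarith)
  have hU8 : 4 * (U : ℝ) ^ 8 ≤ Real.exp U := by
    have := hUpow (show 8 ≤ 20 by norm_num)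
    nlinarith
  have hU6 : 4 * (U : ℝ) ^ 6 ≤ Real.exp U := by
    have := hUpow (show 6 ≤ 8 by norm_num)
    linarith
  have happrox : ∀ {n i j : ℕ}, n ≤ 2 * U ^ 6 → i < n → j < n →
      ‖σ (auxValue δ ξ a m i j) - auxFun (fun x => σ (ξ x)) a θ (i + j * m / a)‖ ≤
        Real.exp (15 * (U : ℝ) ^ 7 - (U : ℝ) ^ 12) := by
    intro n i j hn hi hj
    refine (norm_map_auxValue_sub_auxFun_le hσ hm ha ham hi hj (hξ σ) hΛ).trans ?_
    have h1 : ((2 * U ^ 6 * U ^ 2 : ℕ) : ℝ) ≤ Real.exp U := by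
      push_cast
      nlinarith
    have h2 : ((U ^ 2 : ℕ) : ℝ) * n * (2 * Real.exp (-(U : ℝ) ^ 12)) ≤
        Real.exp U * Real.exp (-(U : ℝ) ^ 12) := by
      have hn' : (n : ℝ) ≤ 2 * U ^ 6 := by exact_mod_cast hn
      calc ((U ^ 2 : ℕ) : ℝ) * n * (2 * Real.exp (-(U : ℝ) ^ 12))
          = (2 * U ^ 2 * n) * Real.exp (-(U : ℝ) ^ 12) := by push_cast; ring
        _ ≤ (2 * U ^ 2 * (2 * U ^ 6)) * Real.exp (-(U : ℝ) ^ 12) := by gcongr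
        _ = (4 * U ^ 8) * Real.exp (-(U : ℝ) ^ 12) := by ring
        _ ≤ _ := by gcongr
    calc _ ≤ Real.exp U * (Real.exp (7 * (U : ℝ) ^ 7) * (Real.exp (6 * (U : ℝ) ^ 7) *
          (Real.exp U * Real.exp (-(U : ℝ) ^ 12)))) := by
          gcongr
          exact polyPart_le_exp hU6 hmU hn
      _ ≤ _ := by
          simp only [← Real.exp_add]
          refine Real.exp_le_exp.2 ?_
          have h3 : (U : ℝ) ≤ U ^ 7 := le_self_pow₀ hU1' (by norm_num)
          linarith
  have hF := norm_auxFun_le_exp hβ hU1 hU hθ hmU ha ham hβa (hξ σ) hN1 hN hNN' hN' hinj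
    (fun i hi j hj => by
      have h := happrox (hNN'.trans hN') hi hj
      rwa [hV i hi j hj, map_zero, zero_sub, norm_neg] at h) hr hs
  set W : ℝ := 14 * (U : ℝ) ^ 7 + (c + 28 * (1 + β)) * (U : ℝ) ^ 2 * N' with hW
  have hVσ : ‖σ (auxValue δ ξ a m r s)‖ ≤ Real.exp (14 * (U : ℝ) ^ 7 +
      28 * (1 + β) * (U : ℝ) ^ 2 * N' - (N : ℝ) ^ 2) := by
    have h1 := happrox hN' hr hs
    have h2 := norm_add_le (σ (auxValue δ ξ a m r s) -
      auxFun (fun x => σ (ξ x)) a θ (r + s * m / a)) (auxFun (fun x => σ (ξ x)) a θ (r + s * m / a))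
    rw [sub_add_cancel] at h2
    have hM : (N : ℝ) ^ 2 ≤ (U : ℝ) ^ 10 := by
      have hNr : (N : ℝ) ≤ U ^ 5 := by exact_mod_cast hN
      calc (N : ℝ) ^ 2 ≤ (U ^ 5) ^ 2 := by gcongr
        _ = _ := by ring
    have h1011 : (U : ℝ) ^ 10 ≤ U ^ 11 := hUpow (by norm_num)
    have h711 : (U : ℝ) ^ 7 ≤ U ^ 11 := hUpow (by norm_num)
    have h1112 : 100 * (U : ℝ) ^ 11 ≤ U ^ 12 := by
      calc 100 * (U : ℝ) ^ 11 ≤ U * U ^ 11 := by gcongr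
        _ = _ := by ring
    have hpos : 0 ≤ 28 * (1 + β) * (U : ℝ) ^ 2 * N' := by positivity
    have hp7 : (0 : ℝ) ≤ (U : ℝ) ^ 7 := by positivity
    set E := Real.exp (12 * (U : ℝ) ^ 7 + 28 * (1 + β) * (U : ℝ) ^ 2 * N' - (N : ℝ) ^ 2) with hE
    have h3 : Real.exp (15 * (U : ℝ) ^ 7 - (U : ℝ) ^ 12) ≤ E := Real.exp_le_exp.2 (by nlinarith)
    have h4 : Real.exp (19 * (U : ℝ) ^ 11 - (U : ℝ) ^ 12) ≤ E := Real.exp_le_exp.2 (by nlinarith)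
    have h5 : (3 : ℝ) ≤ Real.exp (2 * U ^ 7) := by
      have h6 := Real.add_one_le_exp (2 * (U : ℝ) ^ 7)
      have h7 : (1 : ℝ) ≤ U ^ 7 := one_le_pow₀ hU1'
      linarith
    calc ‖σ (auxValue δ ξ a m r s)‖ ≤ 3 * E := by linarith
      _ ≤ Real.exp (2 * U ^ 7) * E := by gcongr
      _ = _ := by rw [hE, ← Real.exp_add]; congr 1; ring
  by_contra hne
  have hsum := sum_auxCoeff_mul (η := η) hηδ (a := a) (m := m) (s := s) hr.le ξ
  have hq0' : (q : k) ≠ 0 := by exact_mod_cast hq0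
  set x : 𝓞 k := ∑ x, auxCoeff η q a m N' r s x * ξ x with hx
  have hx0 : x ≠ 0 := by
    rintro h0
    rw [h0] at hsum
    change algebraMap (𝓞 k) k 0 = _ at hsum
    rw [map_zero, eq_comm] at hsum
    exact mul_ne_zero (pow_ne_zero _ hq0') hne hsum
  have hL := one_le_norm_mul_house_pow σ hx0
  have hhouse := house_scaled_auxValue_le hc hq hη hU8 hU1 hm hmU ham hξ hN' hr hs
  rw [← hx] at hhouse
  have hσx : ‖σ x‖ ≤ Real.exp (W - (N : ℝ) ^ 2) := by
    rw [hsum, map_mul, norm_mul, map_pow, map_natCast, norm_pow, Complex.norm_natCast]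
    calc _ ≤ Real.exp c ^ (U ^ 2 * N') * Real.exp (14 * (U : ℝ) ^ 7 +
          28 * (1 + β) * (U : ℝ) ^ 2 * N' - (N : ℝ) ^ 2) := by gcongr
      _ = _ := by
        rw [← Real.exp_nat_mul, ← Real.exp_add, hW]
        congr 1
        push_cast
        ring
  have hW' : 14 * (U : ℝ) ^ 7 + c * (U : ℝ) ^ 2 * N' ≤ W := by
    have : 0 ≤ 28 * (1 + β) * (U : ℝ) ^ 2 * N' := by positivity
    rw [hW]; linarith
  have hfr : 1 ≤ Module.finrank ℚ k := Module.finrank_pos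
  have : (1 : ℝ) ≤ Real.exp (Module.finrank ℚ k * W - (N : ℝ) ^ 2) := by
    calc (1 : ℝ) ≤ ‖σ x‖ * house (x : k) ^ (Module.finrank ℚ k - 1) := hL
      _ ≤ Real.exp (W - (N : ℝ) ^ 2) * Real.exp W ^ (Module.finrank ℚ k - 1) := by
          have := house_nonneg (x : k)
          gcongr
          exact hhouse.trans (Real.exp_le_exp.2 hW')
      _ = _ := by
          rw [← Real.exp_nat_mul, ← Real.exp_add]
          congr 1
          push_cast [Nat.cast_sub hfr]
          ring
  rw [Real.one_le_exp_iff] at this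
  linarith

theorem exists_small_kernel_vector (k : Type*) [Field k] [NumberField k] :
    ∃ C : ℝ, ∀ (α β : Type) [Fintype α] [Fintype β] (M : Matrix α β (𝓞 k)) (n : ℕ) (A : ℝ),
      M ≠ 0 → 0 < n → Fintype.card α = n → Fintype.card β = 2 * n →
      (∀ i j, house (M i j : k) ≤ A) →
      ∃ ξ : β → 𝓞 k, ξ ≠ 0 ∧ M.mulVec ξ = 0 ∧ ∀ l, house (ξ l : k) ≤ C * (n * A) := by
  classical
  obtain ⟨c, hc⟩ : ∃ c : ℝ, ∀ (α β : Type) [Fintype α] [Fintype β] (M : Matrix α β (𝓞 k)) (p q : ℕ)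
      (A : ℝ), M ≠ 0 → 0 < p → p < q → Fintype.card α = p → Fintype.card β = q →
      (∀ i j, house (M i j : k) ≤ A) →
      ∃ ξ : β → 𝓞 k, ξ ≠ 0 ∧ M.mulVec ξ = 0 ∧
        ∀ l, house (ξ l : k) ≤ c * ((c * q * A) ^ ((p : ℝ) / (q - p))) :=
    ⟨_, fun α β _ _ M p q A hM hp hpq hα hβ hA =>
      house.exists_ne_zero_int_vec_house_le k M hM hp hpq hβ hA hα⟩
  refine ⟨2 * c ^ 2, fun α β _ _ M n A hM hn hα hβ hA => ?_⟩
  obtain ⟨ξ, h1, h2, h3⟩ := hc α β M n (2 * n) A hM hn (by omega) hα hβ hA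
  refine ⟨ξ, h1, h2, fun l => (h3 l).trans (le_of_eq ?_)⟩
  have hn' : (n : ℝ) ≠ 0 := by exact_mod_cast hn.ne'
  have h4 : (n : ℝ) / (((2 * n : ℕ) : ℝ) - n) = 1 := by
    push_cast
    rw [show (2 * n - n : ℝ) = n by ring, div_self hn']
  rw [h4, Real.rpow_one]
  push_cast
  ring

theorem exists_integral_multiple_house_le {k : Type*} [Field k] [NumberField k] (δ : k) :
    ∃ (q : ℕ) (η : 𝓞 k) (c : ℝ), q ≠ 0 ∧ 0 ≤ c ∧ (η : k) = q * δ ∧ (q : ℝ) ≤ Real.exp c ∧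
      ∀ τ : k →+* ℂ, ‖τ η‖ ≤ Real.exp c := by
  have halg : IsAlgebraic ℤ δ :=
    (IsFractionRing.isAlgebraic_iff ℤ ℚ k).2 (Algebra.IsAlgebraic.isAlgebraic δ)
  obtain ⟨y, hy, hint⟩ := halg.exists_integral_multiple
  have hint' : IsIntegral ℤ ((y.natAbs : k) * δ) := by
    rcases Int.natAbs_eq y with h | h
    · rw [h, zsmul_eq_mul] at hint
      simpa using hint
    · rw [h, zsmul_eq_mul] at hint
      simpa using hint.neg
  refine ⟨y.natAbs, ⟨_, hint'⟩, y.natAbs + house ((y.natAbs : k) * δ), by simpa using hy, ?_, rfl,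
    ?_, fun τ => ?_⟩
  · have := house_nonneg ((y.natAbs : k) * δ)
    positivity
  · have := house_nonneg ((y.natAbs : k) * δ)
    have h2 := Real.add_one_le_exp (y.natAbs + house ((y.natAbs : k) * δ))
    linarith
  · have h1 : ‖τ ((y.natAbs : k) * δ)‖ ≤ house ((y.natAbs : k) * δ) :=
      norm_le_pi_norm (canonicalEmbedding k ((y.natAbs : k) * δ)) τ
    have h2 := Real.add_one_le_exp (y.natAbs + house ((y.natAbs : k) * δ))
    have h3 : (0 : ℝ) ≤ y.natAbs := by positivity
    exact h1.trans (by linarith)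

theorem ringOfIntegers_eq_zero_of_auxValue {k : Type*} [Field k] [NumberField k] {δ : k}
    (hδ0 : δ ≠ 0) (hδ : ∀ n : ℕ, 0 < n → δ ^ n ≠ 1) {L₀ L₁ : ℕ} {ξ : Fin L₀ × Fin L₁ → 𝓞 k}
    {a : ℤ} {m : ℕ} (ha : a ≠ 0) (hm : 1 ≤ m)
    (h : ∀ r < L₁, ∀ s < L₀, auxValue δ ξ a m r s = 0) : ξ = 0 := by
  have h1 : ∀ r < L₁, ∀ i : Fin L₀, ∑ j : Fin L₁, (ξ (i, j) : k) * (δ ^ r) ^ (j : ℕ) = 0 := by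
    intro r hr i
    have hv := Matrix.eq_zero_of_forall_index_sum_mul_pow_eq_zero
      (f := fun s : Fin L₀ => ((a : k) * r + m * (s : ℕ)))
      (v := fun i : Fin L₀ => (a : k) ^ (L₀ - i) * ∑ j : Fin L₁, (ξ (i, j) : k) * (δ ^ r) ^ (j : ℕ))
      ?_ ?_
    · have := congrFun hv i
      exact (mul_eq_zero.1 this).resolve_left (pow_ne_zero _ (by exact_mod_cast ha))
    · intro s s' hss
      have hm0 : (m : k) ≠ 0 := by exact_mod_cast (by omega : m ≠ 0)
      have := mul_left_cancel₀ hm0 (add_left_cancel hss)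
      exact Fin.ext (by exact_mod_cast this)
    · intro s
      rw [← h r hr s s.2, auxValue, Fintype.sum_prod_type]
      refine Finset.sum_congr rfl fun i _ => ?_
      rw [Finset.mul_sum, Finset.sum_mul]
      refine Finset.sum_congr rfl fun j _ => ?_
      rw [← pow_mul, mul_comm r]
      ring
  funext x
  obtain ⟨i, j⟩ := x
  have hv := Matrix.eq_zero_of_forall_index_sum_mul_pow_eq_zero
      (f := fun r : Fin L₁ => δ ^ (r : ℕ)) (v := fun j : Fin L₁ => (ξ (i, j) : k)) ?_
      (fun r => h1 r r.2 i)
  · have := congrFun hv j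
    simpa using this
  · have key : ∀ r r' : ℕ, r < r' → δ ^ r ≠ δ ^ r' := by
      intro r r' hr heq
      refine hδ (r' - r) (by omega) ?_
      have : δ ^ r * δ ^ (r' - r) = δ ^ r * 1 := by
        rw [← pow_add, mul_one, heq]; congr 1; omega
      exact mul_left_cancel₀ (pow_ne_zero _ hδ0) this
    intro r r' hrr
    rcases lt_trichotomy (r : ℕ) r' with h | h | h
    · exact absurd hrr (key _ _ h)
    · exact Fin.ext h
    · exact absurd hrr.symm (key _ _ h)

theorem exp_neg_le_norm_pow_sub_one {k : Type*} [Field k] [NumberField k] (σ : k →+* ℂ)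
    {δ : k} {η : 𝓞 k} {q : ℕ} {c : ℝ} (hq0 : q ≠ 0) (hq : (q : ℝ) ≤ Real.exp c)
    (hηδ : (η : k) = q * δ) (hη : ∀ τ : k →+* ℂ, ‖τ η‖ ≤ Real.exp c) {t : ℕ} (ht : δ ^ t ≠ 1) :
    Real.exp (-(Module.finrank ℚ k * (c * t + 1))) ≤ ‖σ δ ^ t - 1‖ := by
  set x : 𝓞 k := η ^ t - q ^ t with hx
  have hxk : (x : k) = q ^ t * (δ ^ t - 1) := by
    rw [hx]
    change algebraMap (𝓞 k) k _ = _
    simp only [map_sub, map_pow, map_natCast, hηδ]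
    ring
  have hq0' : (q : k) ≠ 0 := by exact_mod_cast hq0
  have hx0 : x ≠ 0 := by
    rintro h0
    rw [h0] at hxk
    change algebraMap (𝓞 k) k 0 = _ at hxk
    rw [map_zero, eq_comm] at hxk
    exact mul_ne_zero (pow_ne_zero _ hq0') (sub_ne_zero.2 ht) hxk
  have h1 : house (x : k) ≤ Real.exp (c * t + 1) := by
    refine house_le_of_forall_norm_le (Real.exp_nonneg _) fun τ => ?_
    have h2 : τ x = τ η ^ t - q ^ t := by
      rw [hx]
      change τ (algebraMap (𝓞 k) k _) = _
      simp only [map_sub, map_pow, map_natCast]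
    rw [h2]
    refine (norm_sub_le _ _).trans ?_
    rw [norm_pow, norm_pow, Complex.norm_natCast]
    calc _ ≤ Real.exp c ^ t + Real.exp c ^ t := by gcongr; exact hη τ
      _ = 2 * Real.exp (c * t) := by rw [← Real.exp_nat_mul, mul_comm c]; ring
      _ ≤ Real.exp 1 * Real.exp (c * t) := by
          gcongr
          have := Real.add_one_le_exp (1 : ℝ)
          linarith
      _ = _ := by rw [← Real.exp_add, add_comm]
  have h2 : ‖σ x‖ ≤ Real.exp (c * t + 1) * ‖σ δ ^ t - 1‖ := by
    rw [hxk, map_mul, map_sub, map_pow, map_pow, map_natCast, map_one, norm_mul, norm_pow,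
      Complex.norm_natCast]
    gcongr
    calc (q : ℝ) ^ t ≤ Real.exp c ^ t := by gcongr
      _ = Real.exp (c * t) := by rw [← Real.exp_nat_mul, mul_comm c]
      _ ≤ _ := Real.exp_le_exp.2 (by linarith)
  have hL := one_le_norm_mul_house_pow σ hx0
  have hfr : 1 ≤ Module.finrank ℚ k := Module.finrank_pos
  have h3 : (1 : ℝ) ≤ ‖σ δ ^ t - 1‖ * Real.exp (Module.finrank ℚ k * (c * t + 1)) := by
    calc (1 : ℝ) ≤ ‖σ x‖ * house (x : k) ^ (Module.finrank ℚ k - 1) := hL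
      _ ≤ (Real.exp (c * t + 1) * ‖σ δ ^ t - 1‖) *
            Real.exp (c * t + 1) ^ (Module.finrank ℚ k - 1) := by
          have := house_nonneg (x : k)
          gcongr
      _ = ‖σ δ ^ t - 1‖ * Real.exp (c * t + 1) ^ (Module.finrank ℚ k - 1 + 1) := by ring
      _ = _ := by rw [Nat.sub_add_cancel hfr, ← Real.exp_nat_mul]
  rw [Real.exp_neg, inv_le_iff_one_le_mul₀ (Real.exp_pos _)]
  exact h3

theorem exists_int_abs_sub_le {θ : ℝ} {m : ℕ} :
    ∃ a : ℤ, |m * θ - 2 * Real.pi * a| ≤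
      2 * ‖Complex.exp (θ * Complex.I) ^ m - 1‖ := by
  set a := round (m * θ / (2 * Real.pi)) with ha
  refine ⟨a, ?_⟩
  have hpi := Real.pi_pos
  set x : ℝ := m * θ - 2 * Real.pi * a with hx
  have h1 : |x| ≤ Real.pi := by
    have h := abs_sub_round (m * θ / (2 * Real.pi))
    have h2 : x = 2 * Real.pi * (m * θ / (2 * Real.pi) - a) := by rw [hx]; field_simp
    rw [h2, abs_mul, abs_of_pos (by positivity)]
    nlinarith
  have h2 : Complex.exp (θ * Complex.I) ^ m = Complex.exp (Complex.I * x) := by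
    rw [← Complex.exp_nat_mul, Complex.exp_eq_exp_iff_exists_int]
    refine ⟨a, ?_⟩
    rw [hx]
    push_cast
    ring
  rw [h2, Complex.norm_exp_I_mul_ofReal_sub_one]
  have h3 := Real.mul_abs_le_abs_sin (x := x / 2)
    (by rw [abs_div, abs_of_pos (show (0 : ℝ) < 2 by norm_num)]; linarith)
  rw [Real.norm_eq_abs, abs_mul, abs_of_pos (show (0 : ℝ) < 2 by norm_num)]
  rw [abs_div, abs_of_pos (show (0 : ℝ) < 2 by norm_num)] at h3
  have h4 : |x| / 4 ≤ 2 / Real.pi * (|x| / 2) := by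
    rw [div_mul_div_comm, div_le_div_iff₀ (by positivity) (by positivity)]
    nlinarith [abs_nonneg x, Real.pi_le_four]
  linarith

theorem exists_auxValue_eq_zero {k : Type*} [Field k] [NumberField k] {C : ℝ}
    (hC : ∀ (α β : Type) [Fintype α] [Fintype β] (M : Matrix α β (𝓞 k)) (n : ℕ) (A : ℝ),
      M ≠ 0 → 0 < n → Fintype.card α = n → Fintype.card β = 2 * n →
      (∀ i j, house (M i j : k) ≤ A) →
      ∃ ξ : β → 𝓞 k, ξ ≠ 0 ∧ M.mulVec ξ = 0 ∧ ∀ l, house (ξ l : k) ≤ C * (n * A))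
    {δ : k} {η : 𝓞 k} {q : ℕ} {c : ℝ} (hc : 0 ≤ c) (hq0 : q ≠ 0) (hq : (q : ℝ) ≤ Real.exp c)
    (hηδ : (η : k) = q * δ) (hη : ∀ τ : k →+* ℂ, ‖τ η‖ ≤ Real.exp c)
    {U : ℕ} (hU1 : 2 ≤ U) (hU9 : 2 * (U : ℝ) ^ 9 ≤ Real.exp U) (hCU : C ≤ U) (hcU : c + 1 ≤ U)
    {m : ℕ} {a : ℤ} (hm : 1 ≤ m) (hmU : (m : ℝ) ≤ Real.exp U)
    (ha : a ≠ 0) (ham : |(a : ℝ)| ≤ m) :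
    ∃ ξ : Fin (2 * U ^ 6) × Fin (U ^ 2) → 𝓞 k, ξ ≠ 0 ∧
      (∀ (τ : k →+* ℂ) x, ‖τ (ξ x)‖ ≤ Real.exp (7 * (U : ℝ) ^ 7)) ∧
      ∀ r < U ^ 4, ∀ s < U ^ 4, auxValue δ ξ a m r s = 0 := by
  have hUpos : 0 < U := by omega
  have hU1' : (1 : ℝ) ≤ U := by exact_mod_cast hUpos
  set M : Matrix (Fin (U ^ 4) × Fin (U ^ 4)) (Fin (2 * U ^ 6) × Fin (U ^ 2)) (𝓞 k) :=
    fun i x => auxCoeff η q a m (U ^ 4) i.1 i.2 x with hM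
  set A : ℝ := Real.exp (6 * (U : ℝ) ^ 7 + c * U ^ 6) with hA
  have hq0' : (q : 𝓞 k) ≠ 0 := by exact_mod_cast hq0
  have hM0 : M ≠ 0 := by
    intro h0
    have h1 := congrFun (congrFun h0 (⟨0, by positivity⟩, ⟨0, by positivity⟩))
      (⟨0, by positivity⟩, ⟨0, by positivity⟩)
    simp [hM, auxCoeff, ha, hq0', hUpos.ne'] at h1
  have hMA : ∀ i j, house (M i j : k) ≤ A := by
    intro i j
    refine house_le_of_forall_norm_le (Real.exp_nonneg _) fun τ => ?_
    refine (norm_map_auxCoeff_le hq (Real.one_le_exp hc) hη hm ham i.1.2 i.2.2 j τ).trans ?_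
    have h1 : 2 * (m : ℝ) * ((U ^ 4 : ℕ) : ℝ) ≤ Real.exp (2 * U) := by
      have : (U : ℝ) ^ 4 ≤ (U : ℝ) ^ 9 := pow_le_pow_right₀ hU1' (by norm_num)
      calc 2 * (m : ℝ) * ((U ^ 4 : ℕ) : ℝ) = m * (2 * (U : ℝ) ^ 4) := by push_cast; ring
        _ ≤ Real.exp U * Real.exp U := by gcongr; linarith
        _ = _ := by rw [← Real.exp_add]; congr 1; ring
    calc _ ≤ (Real.exp (2 * U) ^ (2 * U ^ 6) * Real.exp U ^ (2 * U ^ 6)) *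
          Real.exp c ^ (U ^ 2 * U ^ 4) := by gcongr
      _ = A := by
          rw [← Real.exp_nat_mul, ← Real.exp_nat_mul, ← Real.exp_nat_mul, ← Real.exp_add,
            ← Real.exp_add, hA]
          congr 1
          push_cast
          ring
  obtain ⟨ξ, h1, h2, h3⟩ := hC _ _ M (U ^ 8) A hM0 (by positivity)
    (by simp only [Fintype.card_prod, Fintype.card_fin]; ring)
    (by simp only [Fintype.card_prod, Fintype.card_fin]; ring) hMA
  refine ⟨ξ, h1, fun τ x => ?_, fun r hr s hs => ?_⟩
  · have h4 : ‖τ (ξ x)‖ ≤ house (ξ x : k) := norm_le_pi_norm (canonicalEmbedding k (ξ x : k)) τ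
    refine h4.trans ((h3 x).trans ?_)
    calc C * (((U ^ 8 : ℕ) : ℝ) * A) ≤ U * (((U ^ 8 : ℕ) : ℝ) * A) := by gcongr
      _ = (U : ℝ) ^ 9 * A := by push_cast; ring
      _ ≤ Real.exp U * A := by
          gcongr
          have : (0 : ℝ) ≤ (U : ℝ) ^ 9 := by positivity
          linarith
      _ = Real.exp (U + (6 * (U : ℝ) ^ 7 + c * U ^ 6)) := by rw [hA, ← Real.exp_add]
      _ ≤ _ := by
          refine Real.exp_le_exp.2 ?_
          have h5 : (U : ℝ) ≤ U ^ 6 := le_self_pow₀ hU1' (by norm_num)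
          have h6 : (c + 1) * (U : ℝ) ^ 6 ≤ U * U ^ 6 := by gcongr
          nlinarith
  · have h4 := congrFun h2 (⟨r, hr⟩, ⟨s, hs⟩)
    have h5 := sum_auxCoeff_mul (a := a) (m := m) (s := s) hηδ hr.le ξ
    have h6 : ∑ x, auxCoeff η q a m (U ^ 4) r s x * ξ x = 0 := h4
    rw [h6] at h5
    change algebraMap (𝓞 k) k 0 = _ at h5
    rw [map_zero, eq_comm] at h5
    refine (mul_eq_zero.1 h5).resolve_left (pow_ne_zero _ ?_)
    exact_mod_cast hq0

theorem index_injective_of_approx {k : Type*} [Field k] [NumberField k] {σ : k →+* ℂ}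
    {δ : k} (hδ : ∀ n : ℕ, 0 < n → δ ^ n ≠ 1)
    {θ : ℝ} (hσ : σ δ = Complex.exp (θ * Complex.I))
    {η : 𝓞 k} {q : ℕ} {c : ℝ} (hc : 0 ≤ c) (hq0 : q ≠ 0) (hq : (q : ℝ) ≤ Real.exp c)
    (hηδ : (η : k) = q * δ) (hη : ∀ τ : k →+* ℂ, ‖τ η‖ ≤ Real.exp c)
    {U : ℕ} (hU : Module.finrank ℚ k * (c * (U : ℝ) ^ 5 + 1) + U < (U : ℝ) ^ 12)
    (hU5 : 2 * (U : ℝ) ^ 5 ≤ Real.exp U)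
    {m : ℕ} {a : ℤ} (hm : 1 ≤ m)
    (hΛ : |m * θ - 2 * Real.pi * a| ≤ 2 * Real.exp (-(U : ℝ) ^ 12))
    {N : ℕ} (hN : N ≤ U ^ 5) :
    ∀ r < N, ∀ s < N, ∀ r' < N, ∀ s' < N,
      a * r + m * s = a * r' + m * s' → r = r' ∧ s = s' := by
  have hm0 : (0 : ℝ) < m := by exact_mod_cast hm
  have key : ∀ r < N, ∀ s < N, ∀ r' < N, ∀ s' < N,
      a * r + m * s = a * r' + m * s' → ¬ r < r' := by
    intro r hr s hs r' hr' s' hs' h hlt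
    obtain ⟨t, rfl⟩ := Nat.exists_eq_add_of_lt hlt
    set t' := t + 1
    have h1 : a * t' = m * ((s : ℤ) - s') := by
      have : a * (t' : ℤ) = a * ((r + t + 1 : ℕ) : ℤ) - a * r := by push_cast [t']; ring
      linarith
    have h1' : (a : ℝ) * t' = m * ((s : ℝ) - s') := by exact_mod_cast h1
    have hne : δ ^ t' ≠ 1 := hδ t' (Nat.succ_pos _)
    have h2 := exp_neg_le_norm_pow_sub_one σ hq0 hq hηδ hη hne
    set x : ℝ := t' * (m * θ - 2 * Real.pi * a) / m with hx
    have h3 : σ δ ^ t' = Complex.exp (Complex.I * x) := by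
      rw [hσ, ← Complex.exp_nat_mul, Complex.exp_eq_exp_iff_exists_int]
      refine ⟨s - s', ?_⟩
      have : (t' : ℝ) * θ = x + ((s : ℝ) - s') * (2 * Real.pi) := by
        rw [hx]
        field_simp
        linear_combination (2 * Real.pi) * h1'
      have h4 : (t' : ℂ) * θ = x + ((s : ℂ) - s') * (2 * Real.pi) := by exact_mod_cast this
      push_cast
      linear_combination Complex.I * h4
    rw [h3] at h2
    have h4 := h2.trans Real.norm_exp_I_mul_ofReal_sub_one_le
    have ht : (t' : ℝ) ≤ (U : ℝ) ^ 5 := by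
      have : t' ≤ U ^ 5 := by omega
      exact_mod_cast this
    have h5 : ‖x‖ ≤ Real.exp (U - (U : ℝ) ^ 12) := by
      rw [hx, norm_div, norm_mul, Real.norm_eq_abs, Real.norm_eq_abs, Real.norm_eq_abs,
        abs_of_pos hm0, Nat.abs_cast]
      calc _ ≤ (U : ℝ) ^ 5 * (2 * Real.exp (-(U : ℝ) ^ 12)) / 1 := by
            gcongr
            exact_mod_cast hm
        _ = (2 * (U : ℝ) ^ 5) * Real.exp (-(U : ℝ) ^ 12) := by ring
        _ ≤ Real.exp U * Real.exp (-(U : ℝ) ^ 12) := by gcongr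
        _ = _ := by rw [← Real.exp_add]; rfl
    have h6 := Real.exp_le_exp.1 (h4.trans h5)
    have h7 : (Module.finrank ℚ k : ℝ) * (c * t' + 1) ≤
        Module.finrank ℚ k * (c * (U : ℝ) ^ 5 + 1) := by gcongr
    linarith
  intro r hr s hs r' hr' s' hs' h
  have hrr : r = r' := le_antisymm (not_lt.1 (key r' hr' s' hs' r hr s hs h.symm))
    (not_lt.1 (key r hr s hs r' hr' s' hs' h))
  subst hrr
  refine ⟨rfl, ?_⟩
  have hm0' : (m : ℤ) ≠ 0 := by omega
  exact_mod_cast mul_left_cancel₀ hm0' (add_left_cancel h)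

theorem not_approx_of_large {k : Type*} [Field k] [NumberField k] {C : ℝ}
    (hC : ∀ (α β : Type) [Fintype α] [Fintype β] (M : Matrix α β (𝓞 k)) (n : ℕ) (A : ℝ),
      M ≠ 0 → 0 < n → Fintype.card α = n → Fintype.card β = 2 * n →
      (∀ i j, house (M i j : k) ≤ A) →
      ∃ ξ : β → 𝓞 k, ξ ≠ 0 ∧ M.mulVec ξ = 0 ∧ ∀ l, house (ξ l : k) ≤ C * (n * A))
    {σ : k →+* ℂ} {δ : k} (hδ0 : δ ≠ 0) (hδ : ∀ n : ℕ, 0 < n → δ ^ n ≠ 1)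
    {θ : ℝ} (hσ : σ δ = Complex.exp (θ * Complex.I)) (hθ : |θ| ≤ 4)
    {η : 𝓞 k} {q : ℕ} {c : ℝ} (hc : 0 ≤ c) (hq0 : q ≠ 0) (hq : (q : ℝ) ≤ Real.exp c)
    (hηδ : (η : k) = q * δ) (hη : ∀ τ : k →+* ℂ, ‖τ η‖ ≤ Real.exp c)
    {U : ℕ} {β : ℝ} (hβ : 0 ≤ β) (hU100 : 100 ≤ U)
    (hU : 100 * (1 + β) * (U : ℝ) ^ 20 ≤ Real.exp U) (hCU : C ≤ U)
    (hDU : Module.finrank ℚ k * (14 + 2 * (c + 28 * (1 + β))) < U)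
    {m : ℕ} {a : ℤ} (hm : 1 ≤ m) (hmU : (m : ℝ) ≤ Real.exp U)
    (ha : a ≠ 0) (ham : |(a : ℝ)| ≤ m) (hβa : (m : ℝ) ≤ β * |(a : ℝ)|) :
    2 * Real.exp (-(U : ℝ) ^ 12) < |m * θ - 2 * Real.pi * a| := by
  by_contra! hΛ
  have hU100' : (100 : ℝ) ≤ U := by exact_mod_cast hU100
  have hU1' : (1 : ℝ) ≤ U := by linarith
  have hUpow : ∀ {i j : ℕ}, i ≤ j → (U : ℝ) ^ i ≤ (U : ℝ) ^ j :=
    fun h => pow_le_pow_right₀ hU1' h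
  have hβU : (U : ℝ) ^ 20 ≤ (1 + β) * (U : ℝ) ^ 20 :=
    le_mul_of_one_le_left (by positivity) (by linarith)
  have hUj : ∀ {j : ℕ}, j ≤ 20 → 2 * (U : ℝ) ^ j ≤ Real.exp U := by
    intro j hj
    have := hUpow hj
    have : (0 : ℝ) ≤ (U : ℝ) ^ j := by positivity
    linarith
  have hfr : (1 : ℝ) ≤ Module.finrank ℚ k := by
    exact_mod_cast (Module.finrank_pos : 0 < Module.finrank ℚ k)
  set D : ℝ := (Module.finrank ℚ k : ℝ) with hD
  have hcD : c + 1 ≤ D * (c + 1) := le_mul_of_one_le_left (by linarith) hfr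
  have hDc : D * (c + 1) ≤ U := by
      nlinarith [mul_nonneg (by linarith : 0 ≤ D) hc, mul_nonneg (by linarith : 0 ≤ D) hβ]
  have hcol : D * (c * (U : ℝ) ^ 5 + 1) + U < (U : ℝ) ^ 12 := by
    have h1 : D * (c * (U : ℝ) ^ 5 + 1) ≤ D * (c + 1) * (U : ℝ) ^ 5 := by
      have : (1 : ℝ) ≤ (U : ℝ) ^ 5 := one_le_pow₀ hU1'
      nlinarith
    have h2 : D * (c + 1) * (U : ℝ) ^ 5 ≤ U ^ 6 := by
      calc _ ≤ (U : ℝ) * U ^ 5 := by gcongr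
        _ = _ := by ring
    have h3 : (U : ℝ) ≤ U ^ 6 := le_self_pow₀ hU1' (by norm_num)
    have h4 : (100 : ℝ) * U ^ 6 ≤ U ^ 12 := by
      calc (100 : ℝ) * (U : ℝ) ^ 6 ≤ U * (U : ℝ) ^ 6 := by gcongr
        _ = (U : ℝ) ^ 7 := by ring
        _ ≤ _ := hUpow (by norm_num)
    have h5 : (0 : ℝ) < U ^ 6 := by positivity
    linarith
  have hinj := fun N hN =>
      index_injective_of_approx (N := N) hδ hσ hc hq0 hq hηδ hη hcol (hUj (by norm_num)) hm hΛ hN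
  obtain ⟨ξ, hξ0, hξ, hV⟩ := exists_auxValue_eq_zero hC hc hq0 hq hηδ hη (by omega)
    (hUj (by norm_num)) hCU (by linarith) hm hmU ha ham
  have hN45 : U ^ 4 ≤ U ^ 5 := Nat.pow_le_pow_right (by omega) (by norm_num)
  have hN56 : U ^ 5 ≤ U ^ 6 := Nat.pow_le_pow_right (by omega) (by norm_num)
  have hN26 : U ^ 2 ≤ U ^ 6 := Nat.pow_le_pow_right (by omega) (by norm_num)
  have hc' : 0 ≤ c + 28 * (1 + β) := by linarith
  have hDc' : 0 ≤ D * (c + 28 * (1 + β)) := mul_nonneg (by linarith) hc'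
  have hV5 := auxValue_eq_zero_of_extrapolation hσ hθ hc hq0 hq hηδ hη hβ hU100 hU hm hmU ha ham
    hβa hΛ hξ (N := U ^ 4) (N' := U ^ 5) (Nat.one_le_pow _ _ (by omega)) hN45 hN45 (by omega)
    (hinj _ hN45) (by
      have h7 : (0 : ℝ) < (U : ℝ) ^ 7 := by positivity
      have h8 : D * (14 + 2 * (c + 28 * (1 + β))) * (U : ℝ) ^ 7 < U * U ^ 7 := by gcongr
      have h9 := mul_nonneg hDc' h7.le
      push_cast
      ring_nf at h8 h9 ⊢
      linarith) hV
  have hV6 := auxValue_eq_zero_of_extrapolation hσ hθ hc hq0 hq hηδ hη hβ hU100 hU hm hmU ha ham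
    hβa hΛ hξ (N := U ^ 5) (N' := 2 * U ^ 6) (Nat.one_le_pow _ _ (by omega)) le_rfl (by omega)
    le_rfl (hinj _ le_rfl) (by
      have h7 : (0 : ℝ) < (U : ℝ) ^ 9 := by positivity
      have h8 : D * (14 + 2 * (c + 28 * (1 + β))) * (U : ℝ) ^ 9 < U * U ^ 9 := by gcongr
      have h9 : D * (U : ℝ) ^ 7 ≤ D * U ^ 9 :=
        mul_le_mul_of_nonneg_left (hUpow (by norm_num)) (by linarith)
      have h10 : D * (c + 28 * (1 + β)) * (U : ℝ) ^ 8 ≤ D * (c + 28 * (1 + β)) * U ^ 9 :=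
        mul_le_mul_of_nonneg_left (hUpow (by norm_num)) hDc'
      push_cast
      ring_nf at h8 h9 h10 ⊢
      linarith) hV5
  exact hξ0 (ringOfIntegers_eq_zero_of_auxValue hδ0 hδ ha hm fun r hr s hs =>
    hV6 r (by omega) s hs)

/-- A lower bound for `‖σ δ ^ m - 1‖` on the unit circle. -/
theorem exists_forall_exp_neg_le_norm_pow_sub_one {k : Type*} [Field k] [NumberField k]
    (σ : k →+* ℂ) {δ : k} (hδ : ∀ n : ℕ, 0 < n → δ ^ n ≠ 1) (h1 : ‖σ δ‖ = 1) :
    ∃ U₀ : ℕ, ∀ U ≥ U₀, ∀ m : ℕ, 1 ≤ m → (m : ℝ) ≤ Real.exp U →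
      Real.exp (-(U : ℝ) ^ 12) ≤ ‖σ δ ^ m - 1‖ := by
  have hδ0 : δ ≠ 0 := by
    rintro rfl
    simp at h1
  obtain ⟨C, hC⟩ := exists_small_kernel_vector k
  obtain ⟨q, η, c, hq0, hc, hηδ, hq, hη⟩ := exists_integral_multiple_house_le δ
  set θ : ℝ := Complex.arg (σ δ) with hθdef
  have hσ : σ δ = Complex.exp (θ * Complex.I) := by
    have := Complex.norm_mul_exp_arg_mul_I (σ δ)
    rw [h1, Complex.ofReal_one, one_mul] at this
    exact this.symm
  have hθπ : |θ| ≤ Real.pi := Complex.abs_arg_le_pi _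
  have hθ4 : |θ| ≤ 4 := hθπ.trans Real.pi_le_four
  have hθ0 : θ ≠ 0 := by
    intro h
    rw [h] at hσ
    simp only [Complex.ofReal_zero, zero_mul, Complex.exp_zero] at hσ
    refine hδ 1 one_pos ?_
    rw [pow_one]
    exact σ.injective (by rw [hσ, map_one])
  have hθpos : 0 < |θ| := abs_pos.2 hθ0
  have hpi := Real.pi_pos
  set β : ℝ := 4 * Real.pi / |θ| with hβdef
  have hβ : 0 ≤ β := by positivity
  have htend := Real.tendsto_exp_div_pow_atTop 20
  obtain ⟨U₁, hU₁⟩ := Filter.eventually_atTop.1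
    ((htend.comp tendsto_natCast_atTop_atTop).eventually_ge_atTop (100 * (1 + β)))
  obtain ⟨U₂, hU₂⟩ := exists_nat_gt (max C (max (4 / |θ|)
    (Module.finrank ℚ k * (14 + 2 * (c + 28 * (1 + β))))))
  refine ⟨max 100 (max U₁ U₂), fun U hU m hm hmU => ?_⟩
  have hU100 : 100 ≤ U := le_trans (le_max_left _ _) hU
  have hUU₁ : U₁ ≤ U := (le_max_left _ _).trans ((le_max_right _ _).trans hU)
  have hUU₂ : (U₂ : ℝ) ≤ U := by
    exact_mod_cast (le_max_right _ _).trans ((le_max_right _ _).trans hU)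
  have hU100' : (100 : ℝ) ≤ U := by exact_mod_cast hU100
  have hmax := hU₂.trans_le hUU₂
  rw [max_lt_iff, max_lt_iff] at hmax
  obtain ⟨hCU, hθU, hDU⟩ := hmax
  have hexpU : 100 * (1 + β) * (U : ℝ) ^ 20 ≤ Real.exp U := by
    have := hU₁ U hUU₁
    simp only [Function.comp] at this
    rwa [le_div_iff₀ (by positivity)] at this
  obtain ⟨a, ha⟩ := exists_int_abs_sub_le (θ := θ) (m := m)
  rw [← hσ] at ha
  by_contra! hlt
  have hΛ : |m * θ - 2 * Real.pi * a| ≤ 2 * Real.exp (-(U : ℝ) ^ 12) := ha.trans (by linarith)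
  have hm1 : (1 : ℝ) ≤ m := by exact_mod_cast hm
  have hsmall : 2 * Real.exp (-(U : ℝ) ^ 12) ≤ |θ| / 2 := by
    have h2 : (U : ℝ) ≤ U ^ 12 := le_self_pow₀ (by linarith) (by norm_num)
    have h3 : (U : ℝ) ≤ Real.exp ((U : ℝ) ^ 12) := by
      have := Real.add_one_le_exp ((U : ℝ) ^ 12)
      linarith
    have h4 : 4 ≤ |θ| * Real.exp ((U : ℝ) ^ 12) := by
      rw [div_lt_iff₀ hθpos] at hθU
      nlinarith
    rw [Real.exp_neg]
    have h5 := Real.exp_pos ((U : ℝ) ^ 12)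
    rw [← div_eq_mul_inv, div_le_iff₀ h5]
    linarith
  have hmθ : |(m : ℝ) * θ| = m * |θ| := by rw [abs_mul, Nat.abs_cast]
  have h2πa : |2 * Real.pi * (a : ℝ)| = 2 * Real.pi * |(a : ℝ)| := by
    rw [abs_mul, abs_of_pos (by positivity : 0 < 2 * Real.pi)]
  have hsub1 := abs_sub_abs_le_abs_sub ((m : ℝ) * θ) (2 * Real.pi * a)
  have hsub2 := abs_sub_abs_le_abs_sub (2 * Real.pi * (a : ℝ)) (m * θ)
  rw [abs_sub_comm (2 * Real.pi * (a : ℝ))] at hsub2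
  rw [hmθ, h2πa] at hsub1 hsub2
  have hmθ1 : |θ| ≤ m * |θ| := le_mul_of_one_le_left hθpos.le hm1
  have hβa : (m : ℝ) ≤ β * |(a : ℝ)| := by
    rw [hβdef, div_mul_eq_mul_div, le_div_iff₀ hθpos]
    linarith
  have ha0 : a ≠ 0 := by
    rintro rfl
    simp at hβa
    omega
  have ham : |(a : ℝ)| ≤ m := by
    have h3 : (m : ℝ) * |θ| ≤ m * Real.pi := by gcongr
    have h4 : 2 * Real.pi * |(a : ℝ)| ≤ 2 * Real.pi * m := by
      nlinarith
    exact le_of_mul_le_mul_left h4 (by positivity)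
  exact absurd hΛ (not_le.2 (not_approx_of_large hC hδ0 hδ hσ hθ4 hc hq0 hq hηδ hη hβ hU100 hexpU
    hCU.le hDU hm hmU ha0 ham hβa))

open Polynomial in
theorem IsNonarchimedean.sum_le_of_forall_le {K ι : Type*} [Field K] {v : AbsoluteValue K ℝ}
    (hv : IsNonarchimedean v) {s : Finset ι} {f : ι → K} {B : ℝ} (hB : 0 ≤ B)
    (h : ∀ i ∈ s, v (f i) ≤ B) : v (∑ i ∈ s, f i) ≤ B := by
  classical
  induction s using Finset.induction with
  | empty => simpa using hB
  | insert a s ha ih =>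
    rw [Finset.sum_insert ha]
    exact (hv _ _).trans (max_le (h a (Finset.mem_insert_self a s))
      (ih fun i hi => h i (Finset.mem_insert_of_mem hi)))

open Polynomial in
theorem IsNonarchimedean.aeval_le_one {K : Type*} [Field K] {v : AbsoluteValue K ℝ}
    (hv : IsNonarchimedean v) {x : K} (hx : v x ≤ 1) (P : ℤ[X]) : v (aeval x P) ≤ 1 := by
  rw [aeval_eq_sum_range]
  refine hv.sum_le_of_forall_le zero_le_one fun i _ => ?_
  rw [zsmul_eq_mul, map_mul, map_pow]
  exact mul_le_one₀ (hv.apply_intCast_le_one) (by positivity) (pow_le_one₀ (by positivity) hx)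

open Polynomial in
theorem IsNonarchimedean.aeval_eq_one {K : Type*} [Field K] {v : AbsoluteValue K ℝ}
    (hv : IsNonarchimedean v) {x : K} (hx : v x < 1) {P : ℤ[X]} (hP : P.coeff 0 = 1) :
    v (aeval x P) = 1 := by
  have h1 : aeval x P = x * aeval x P.divX + 1 := by
    conv_lhs => rw [← X_mul_divX_add P, hP]
    simp
  have h2 : v (x * aeval x P.divX) < v 1 := by
    rw [map_mul, map_one]
    exact mul_lt_one_of_nonneg_of_lt_one_left (by positivity) hx (hv.aeval_le_one hx.le _)
  rw [h1, hv.add_eq_right_of_lt h2, map_one]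

open Polynomial in
theorem IsNonarchimedean.aeval_eq_pow {K : Type*} [Field K] {v : AbsoluteValue K ℝ}
    (hv : IsNonarchimedean v) {x : K} (hx : 1 < v x) {P : ℤ[X]} (hP : P.Monic) :
    v (aeval x P) = v x ^ P.natDegree := by
  have h1 : aeval x P =
      x ^ P.natDegree + ∑ i ∈ Finset.range P.natDegree, (P.coeff i : K) * x ^ i := by
    conv_lhs => rw [hP.as_sum]
    simp
  rw [h1, hv.add_eq_left_of_lt, map_pow]
  rw [map_pow]
  rcases Nat.eq_zero_or_pos P.natDegree with h | h
  · simp [h]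
  · obtain ⟨d, hd⟩ := Nat.exists_eq_succ_of_ne_zero h.ne'
    rw [hd]
    refine lt_of_le_of_lt (hv.sum_le_of_forall_le (B := v x ^ d) (by positivity) fun i hi => ?_)
      (pow_lt_pow_right₀ hx d.lt_succ_self)
    rw [map_mul, map_pow, ← one_mul (v x ^ d)]
    gcongr
    · exact hv.apply_intCast_le_one
    · exact hx.le
    · have := Finset.mem_range.1 hi
      omega

theorem IsNonarchimedean.pow_sub_one_le {K : Type*} [Field K] {v : AbsoluteValue K ℝ}
    (hv : IsNonarchimedean v) {x : K} (hx : v x ≤ 1) (n : ℕ) : v (x ^ n - 1) ≤ v (x - 1) := by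
  rw [← geom_sum_mul, map_mul]
  refine mul_le_of_le_one_left (by positivity) (hv.sum_le_of_forall_le zero_le_one fun i _ => ?_)
  rw [map_pow]
  exact pow_le_one₀ (by positivity) hx

theorem IsNonarchimedean.geom_sum_eq_one {K : Type*} [Field K] {v : AbsoluteValue K ℝ}
    (hv : IsNonarchimedean v) {x : K} (hx : v (x - 1) < 1) {n : ℕ} (hn : v n = 1) :
    v (∑ i ∈ Finset.range n, x ^ i) = 1 := by
  have hx1 : v x ≤ 1 := by
    have := hv (x - 1) 1
    rw [sub_add_cancel, map_one] at this
    exact this.trans (max_le hx.le le_rfl)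
  have h1 : ∑ i ∈ Finset.range n, x ^ i = ∑ i ∈ Finset.range n, (x ^ i - 1) + n := by
    rw [Finset.sum_sub_distrib]
    simp
  have h2 : v (∑ i ∈ Finset.range n, (x ^ i - 1)) < v n := by
    rw [hn]
    exact (hv.sum_le_of_forall_le (by positivity) fun i _ => hv.pow_sub_one_le hx1 i).trans_lt hx
  rw [h1, hv.add_eq_right_of_lt h2, hn]

/-- Binomial expansion of a prime power near `1`. -/
theorem IsNonarchimedean.exists_prime_pow_sub_one_eq {K : Type*} [Field K] {v : AbsoluteValue K ℝ}
    (hv : IsNonarchimedean v) {x : K} (hx : v (x - 1) < 1) {p : ℕ} (hp : p.Prime) :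
    ∃ y : K, v y = 1 ∧ x ^ p - 1 = (x - 1) * ((x - 1) ^ (p - 1) + p * y) := by
  refine ⟨∑ k ∈ Finset.Ioo 0 p, (x - 1) ^ (k - 1) * ((p.choose k / p : ℕ) : K), ?_, ?_⟩
  · have h1 : ∑ k ∈ Finset.Ioo 0 p, (x - 1) ^ (k - 1) * ((p.choose k / p : ℕ) : K) =
        Polynomial.aeval (x - 1) (∑ k ∈ Finset.Ioo 0 p,
          (Polynomial.X : Polynomial ℤ) ^ (k - 1) * ((p.choose k / p : ℕ) : Polynomial ℤ)) := by
      simp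
    rw [h1]
    refine hv.aeval_eq_one hx ?_
    rw [Polynomial.finsetSum_coeff, Finset.sum_eq_single 1]
    · simp [Nat.div_self hp.pos, Polynomial.coeff_one_zero]
    · intro b hb hb1
      have := Finset.mem_Ioo.1 hb
      have hb2 : b - 1 ≠ 0 := by omega
      rw [Polynomial.mul_coeff_zero, Polynomial.coeff_X_pow, if_neg hb2.symm, zero_mul]
    · intro h
      exact absurd (Finset.mem_Ioo.2 ⟨one_pos, hp.one_lt⟩) h
  · have h := add_pow_prime_eq hp (x - 1) 1
    rw [sub_add_cancel] at h
    have h2 : (x - 1) ^ p = (x - 1) * (x - 1) ^ (p - 1) := by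
      rw [← pow_succ', Nat.sub_add_cancel hp.one_lt.le]
    simp only [one_pow, mul_one] at h
    rw [h, h2]
    ring

theorem IsNonarchimedean.pow_prime_pow_sub_one_le {K : Type*} [Field K] {v : AbsoluteValue K ℝ}
    (hv : IsNonarchimedean v) {r : ℝ} (hr1 : r < 1) (hr : ∀ x, v x < 1 → v x ≤ r) {x : K}
    (hx : v (x - 1) < 1) {p : ℕ} (hp : p.Prime) (hvp : v p < 1) (t : ℕ) :
    v (x ^ p ^ t - 1) ≤ r ^ (t + 1) := by
  have hr0 : 0 ≤ r := (apply_nonneg v (x - 1)).trans (hr _ hx)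
  induction t with
  | zero => simpa using hr _ hx
  | succ t ih =>
    have hlt : v (x ^ p ^ t - 1) < 1 := ih.trans_lt (pow_lt_one₀ hr0 hr1 (Nat.succ_ne_zero t))
    obtain ⟨y, hy1, hy⟩ := hv.exists_prime_pow_sub_one_eq hlt hp
    rw [pow_succ p, pow_mul, hy, map_mul, pow_succ r]
    refine mul_le_mul ih ((hv _ _).trans (max_le ?_ ?_)) (by positivity) (by positivity)
    · rw [map_pow]
      exact (pow_le_of_le_one (by positivity) hlt.le (Nat.sub_ne_zero_of_lt hp.one_lt)).trans
        (hr _ hlt)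
    · rw [map_mul, hy1, mul_one]
      exact hr _ hvp

open Polynomial in
theorem IsNonarchimedean.geom_sum_le_cyclotomic {K : Type*} [Field K] {v : AbsoluteValue K ℝ}
    (hv : IsNonarchimedean v) {δ : K} (hδ : ∀ n : ℕ, 0 < n → δ ^ n ≠ 1) (h1 : v δ ≤ 1)
    {n l : ℕ} (hn : 0 < n) (hl : 1 < l) :
    v (∑ i ∈ Finset.range l, (δ ^ n) ^ i) ≤ v (aeval δ (cyclotomic (n * l) ℤ)) := by
  obtain ⟨R, hR⟩ := X_pow_sub_one_mul_cyclotomic_dvd_X_pow_sub_one_of_dvd ℤ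
    (d := n) (n := n * l) (Nat.mem_properDivisors.2 ⟨dvd_mul_right _ _, by nlinarith⟩)
  have h2 := congrArg (aeval δ) hR
  simp only [map_mul, map_sub, map_pow, aeval_X, map_one] at h2
  rw [pow_mul, ← geom_sum_mul, mul_comm, mul_assoc] at h2
  rw [mul_left_cancel₀ (sub_ne_zero.2 (hδ n hn)) h2, map_mul]
  exact mul_le_of_le_one_right (by positivity) (hv.aeval_le_one h1 R)

open Polynomial in
theorem IsNonarchimedean.natCast_le_cyclotomic {K : Type*} [Field K] {v : AbsoluteValue K ℝ}
    (hv : IsNonarchimedean v) {r : ℝ} (hr1 : r < 1) (hr : ∀ x, v x < 1 → v x ≤ r) {δ : K}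
    (hδ : ∀ n : ℕ, 0 < n → δ ^ n ≠ 1) (h1 : v δ = 1) {d D m : ℕ} (hd0 : 0 < d)
    (hd : ∀ n : ℕ, v (δ ^ n - 1) < 1 ↔ d ∣ n) (hdm : d ≠ m)
    (hp : ∀ p : ℕ, p.Prime → v p < 1 → r ^ (D + 1) < v p ∧ d ≤ p ^ D)
    (hm : (D + 1) ^ (2 * D) < m) :
    v m ≤ v (aeval δ (cyclotomic m ℤ)) := by
  have hm0 : 0 < m := by omega
  by_cases hlt : v (aeval δ (cyclotomic m ℤ)) < 1
  swap
  · exact hv.apply_natCast_le_one.trans (not_lt.1 hlt)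
  have hdvd : d ∣ m := by
    rw [← hd]
    have h2 : aeval δ (X ^ m - 1 : ℤ[X]) = δ ^ m - 1 := by simp
    obtain ⟨R, hR⟩ := cyclotomic.dvd_X_pow_sub_one m ℤ
    rw [← h2, hR, map_mul, map_mul]
    exact mul_lt_one_of_nonneg_of_lt_one_left (by positivity) hlt (hv.aeval_le_one h1.le R)
  obtain ⟨s, rfl⟩ := hdvd
  have hs0 : 0 < s := Nat.pos_of_mul_pos_left hm0
  have hs1 : s ≠ 1 := by
    rintro rfl
    simp at hdm
  have hprime : ∀ l : ℕ, l.Prime → l ∣ s → v l < 1 := by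
    intro l hl hls
    obtain ⟨e, rfl⟩ := hls
    by_contra! hvl
    have h2 := hv.geom_sum_le_cyclotomic hδ h1.le (n := d * e) (l := l)
      (Nat.mul_pos hd0 (Nat.pos_of_mul_pos_left hs0)) hl.one_lt
    rw [hv.geom_sum_eq_one ((hd _).2 (dvd_mul_right _ _))
      (le_antisymm hv.apply_natCast_le_one hvl)] at h2
    rw [show d * e * l = d * (l * e) by ring] at h2
    exact absurd hlt (not_lt.2 h2)
  obtain ⟨p, hpp, hps⟩ := Nat.exists_prime_and_dvd hs1
  have hvp := hprime p hpp hps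
  have hs : s = p ^ s.primeFactorsList.length := by
    refine Nat.eq_prime_pow_of_unique_prime_dvd hs0.ne' fun {l} hl hls => ?_
    by_contra hne
    have hcop : IsCoprime (l : ℤ) p :=
        Nat.isCoprime_iff_coprime.2 ((Nat.coprime_primes hl hpp).2 hne)
    obtain ⟨a, b, hab⟩ := hcop
    have h3 : ((a : K) * l + b * p) = 1 := by exact_mod_cast congrArg (Int.cast : ℤ → K) hab
    have h4 : v ((a : K) * l + b * p) < 1 := by
      refine (hv _ _).trans_lt (max_lt ?_ ?_)
      · rw [map_mul]
        exact mul_lt_one_of_nonneg_of_lt_one_right (hv.apply_intCast_le_one) (by positivity)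
          (hprime l hl hls)
      · rw [map_mul]
        exact mul_lt_one_of_nonneg_of_lt_one_right (hv.apply_intCast_le_one) (by positivity) hvp
    rw [h3, map_one] at h4
    exact lt_irrefl _ h4
  set t := s.primeFactorsList.length with ht
  have ht0 : t ≠ 0 := by
    intro h
    rw [h, pow_zero] at hs
    exact hs1 hs
  obtain ⟨t', ht'⟩ := Nat.exists_eq_succ_of_ne_zero ht0
  obtain ⟨hrp, hdp⟩ := hp p hpp hvp
  have hr0 : 0 ≤ r := (apply_nonneg v _).trans (hr _ hvp)
  have hlarge : D + 1 ≤ t * (p - 1) := by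
    by_contra! hcon
    have hp1 : 1 ≤ p - 1 := Nat.sub_pos_of_lt hpp.one_lt
    have htD : t ≤ D := by nlinarith
    have hpD : p ≤ D + 1 := by
      have : 1 ≤ t := Nat.one_le_iff_ne_zero.2 ht0
      have : p - 1 ≤ D := by nlinarith
      omega
    have h5 : d * s ≤ (D + 1) ^ (2 * D) := by
      calc d * s ≤ p ^ D * p ^ D := by
            gcongr
            rw [hs]
            exact Nat.pow_le_pow_right hpp.pos htD
        _ = p ^ (2 * D) := by rw [← pow_add]; congr 1; ring
        _ ≤ _ := Nat.pow_le_pow_left hpD _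
    omega
  have hw := hv.pow_prime_pow_sub_one_le hr1 hr (x := δ ^ d) ((hd d).2 dvd_rfl) hpp hvp t'
  have hwlt : v ((δ ^ d) ^ p ^ t' - 1) < 1 :=
    hw.trans_lt (pow_lt_one₀ hr0 hr1 (Nat.succ_ne_zero t'))
  obtain ⟨y, hy1, hy⟩ := hv.exists_prime_pow_sub_one_eq hwlt hpp
  have hne : (δ ^ d) ^ p ^ t' - 1 ≠ 0 := by
    rw [← pow_mul]
    exact sub_ne_zero.2 (hδ _ (Nat.mul_pos hd0 (pow_pos hpp.pos _)))
  rw [← geom_sum_mul, mul_comm] at hy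
  have hgeom := mul_left_cancel₀ hne hy
  have h6 : v (((δ ^ d) ^ p ^ t' - 1) ^ (p - 1)) < v (p * y) := by
    rw [map_mul, hy1, mul_one, map_pow]
    refine lt_of_le_of_lt ?_ hrp
    calc v ((δ ^ d) ^ p ^ t' - 1) ^ (p - 1) ≤ (r ^ (t' + 1)) ^ (p - 1) := by gcongr
      _ = r ^ (t * (p - 1)) := by rw [← pow_mul, ht']
      _ ≤ r ^ (D + 1) := pow_le_pow_of_le_one hr0 hr1.le hlarge
  have h7 := hv.geom_sum_le_cyclotomic hδ h1.le (n := d * p ^ t') (l := p)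
      (Nat.mul_pos hd0 (pow_pos hpp.pos _)) hpp.one_lt
  rw [pow_mul, hgeom, hv.add_eq_right_of_lt h6, map_mul, hy1, mul_one] at h7
  have h8 : d * p ^ t' * p = d * s := by rw [hs, ht', pow_succ]; ring
  rw [h8] at h7
  refine le_trans ?_ h7
  rw [← h8]
  push_cast
  rw [map_mul]
  refine mul_le_of_le_one_left (by positivity) ?_
  have := hv.apply_natCast_le_one (n := d * p ^ t')
  push_cast at this
  exact this

open Polynomial in
theorem IsNonarchimedean.natCast_mul_max_pow_le_cyclotomic {K : Type*} [Field K]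
    {v : AbsoluteValue K ℝ} (hv : IsNonarchimedean v) {δ : K} {m : ℕ} (hm : 1 < m)
    (h1 : v δ = 1 → v m ≤ v (aeval δ (cyclotomic m ℤ))) :
    v m * max (v δ) 1 ^ m.totient ≤ v (aeval δ (cyclotomic m ℤ)) := by
  have hvm : v (m : K) ≤ 1 := hv.apply_natCast_le_one
  rcases lt_trichotomy (v δ) 1 with h | h | h
  · rw [max_eq_right h.le, one_pow, mul_one, hv.aeval_eq_one h (cyclotomic_coeff_zero ℤ hm)]
    exact hvm
  · rw [h, max_self, one_pow, mul_one]
    exact h1 h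
  · rw [max_eq_left h.le, hv.aeval_eq_pow h (cyclotomic.monic m ℤ), natDegree_cyclotomic]
    exact mul_le_of_le_one_left (by positivity) hvm

theorem Nat.succ_pow_four_mul_pow_le (b : ℕ) {p : ℕ} (hp : p.Prime) :
    (b + 2) ^ 4 * p ^ (b + 1) ≤ (if p < 5 then 32 else 1) * (p ^ b * (p - 1)) ^ 4 := by
  obtain ⟨q, rfl⟩ := Nat.exists_eq_succ_of_ne_zero hp.ne_zero
  have hq : 1 ≤ q := by have := hp.two_le; omega
  simp only [Nat.succ_eq_add_one, Nat.add_sub_cancel]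
  induction b with
  | zero =>
    split_ifs with h
    · have : q ≤ 3 := by omega
      interval_cases q <;> norm_num
    · have h4 : 4 ≤ q := by omega
      have : 4 ^ 3 * q ≤ q ^ 3 * q := by gcongr
      simp only [zero_add, pow_one, pow_zero, one_mul]
      nlinarith
  | succ b ih =>
    have h1 : (b + 3) ^ 4 ≤ 8 * (b + 2) ^ 4 := by
      have h : (2 * (b + 3)) ^ 4 ≤ (3 * (b + 2)) ^ 4 := Nat.pow_le_pow_left (by omega) 4
      rw [mul_pow, mul_pow] at h
      omega
    have h2 : 8 ≤ (q + 1) ^ 3 := by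
      have := Nat.pow_le_pow_left (show 2 ≤ q + 1 by omega) 3
      norm_num at this
      exact this
    calc (b + 1 + 2) ^ 4 * (q + 1) ^ (b + 1 + 1)
        ≤ (8 * (b + 2) ^ 4) * (q + 1) ^ (b + 1 + 1) := by gcongr
      _ = 8 * (q + 1) * ((b + 2) ^ 4 * (q + 1) ^ (b + 1)) := by ring
      _ ≤ (q + 1) ^ 3 * (q + 1) *
          ((if q + 1 < 5 then 32 else 1) * ((q + 1) ^ b * q) ^ 4) := by gcongr
      _ = _ := by ring

theorem Nat.card_divisors_pow_four_mul_le {m : ℕ} (hm : m ≠ 0) :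
    m.divisors.card ^ 4 * m ≤ 32 ^ 5 * m.totient ^ 4 := by
  have h1 : m.divisors.card ^ 4 * m =
      ∏ p ∈ m.primeFactors, ((m.factorization p + 1) ^ 4 * p ^ m.factorization p) := by
    rw [Finset.prod_mul_distrib, Finset.prod_pow, ← Nat.card_divisors hm]
    congr 1
    exact (Nat.prod_factorization_pow_eq_self hm).symm
  have h2 : m.totient = ∏ p ∈ m.primeFactors, (p ^ (m.factorization p - 1) * (p - 1)) :=
    Nat.totient_eq_prod_factorization hm
  have h3 : ∏ p ∈ m.primeFactors, (if p < 5 then 32 else 1) ≤ 32 ^ 5 := by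
    rw [← Finset.prod_filter, Finset.prod_const]
    refine Nat.pow_le_pow_right (by norm_num) ?_
    refine (Finset.card_le_card (t := Finset.range 5) fun p hp => ?_).trans (by simp)
    exact Finset.mem_range.2 (Finset.mem_filter.1 hp).2
  calc m.divisors.card ^ 4 * m
      ≤ ∏ p ∈ m.primeFactors, ((if p < 5 then 32 else 1) *
          (p ^ (m.factorization p - 1) * (p - 1)) ^ 4) := by
        rw [h1]
        refine Finset.prod_le_prod' fun p hp => ?_
        have hpp := Nat.prime_of_mem_primeFactors hp
        obtain ⟨b, hb⟩ := Nat.exists_eq_succ_of_ne_zero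
          (hpp.factorization_pos_of_dvd hm (Nat.dvd_of_mem_primeFactors hp)).ne'
        rw [hb]
        exact Nat.succ_pow_four_mul_pow_le b hpp
    _ = (∏ p ∈ m.primeFactors, (if p < 5 then 32 else 1)) * m.totient ^ 4 := by
        rw [Finset.prod_mul_distrib, Finset.prod_pow, ← h2]
    _ ≤ _ := by gcongr

theorem Nat.card_divisors_mul_rpow_le {m : ℕ} (hm : m ≠ 0) :
    (m.divisors.card : ℝ) * (m : ℝ) ^ (1 / 4 : ℝ) ≤ 32 ^ 2 * m.totient := by
  refine le_of_pow_le_pow_left₀ (n := 4) (by norm_num) (by positivity) ?_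
  rw [mul_pow, ← Real.rpow_natCast ((m : ℝ) ^ (1 / 4 : ℝ)), ← Real.rpow_mul (by positivity)]
  norm_num only [Nat.cast_ofNat, one_div, inv_mul_cancel₀, Real.rpow_one, mul_pow]
  have h : (m.divisors.card : ℝ) ^ 4 * m ≤ 32 ^ 5 * (m.totient : ℝ) ^ 4 := by
    exact_mod_cast Nat.card_divisors_pow_four_mul_le hm
  refine h.trans ?_
  gcongr
  norm_num

open Filter Asymptotics in
theorem eventually_card_divisors_mul_log_lt_totient (A C D : ℝ) (hD : 0 ≤ D) {h : ℝ} (hh : 0 < h) :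
    ∀ᶠ m : ℕ in atTop, (m.divisors.card : ℝ) * (A * (C + (Real.log m + 2) ^ 12)) + D * Real.log m <
      m.totient * h := by
  have h1 : (fun x : ℝ => A * (C + (Real.log x + 2) ^ 12) + D * Real.log x)
      =o[atTop] fun x => x ^ (1 / 4 : ℝ) := by
    have hq : (0 : ℝ) < 1 / 4 := by norm_num
    have hl := isLittleO_log_rpow_atTop hq
    have hc (c : ℝ) : (fun _ : ℝ => c) =o[atTop] fun x : ℝ => x ^ (1 / 4 : ℝ) :=
      isLittleO_const_left.2 (Or.inr (tendsto_norm_atTop_atTop.comp (tendsto_rpow_atTop hq)))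
    have hl2 : (fun x : ℝ => (Real.log x + 2) ^ 12) =o[atTop] fun x : ℝ => x ^ (1 / 4 : ℝ) := by
      have hs : (fun x : ℝ => Real.log x + 2) =o[atTop] fun x : ℝ => x ^ (1 / 48 : ℝ) :=
        (isLittleO_log_rpow_atTop (by norm_num)).add
          (isLittleO_const_left.2 (Or.inr (tendsto_norm_atTop_atTop.comp
            (tendsto_rpow_atTop (by norm_num)))))
      refine (hs.pow (n := 12) (by norm_num)).congr' EventuallyEq.rfl ?_
      filter_upwards [eventually_ge_atTop 0] with x hx
      rw [← Real.rpow_natCast, ← Real.rpow_mul hx]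
      norm_num
    exact (((hc C).add hl2).const_mul_left A).add (hl.const_mul_left D)
  have h2 := (h1.comp_tendsto tendsto_natCast_atTop_atTop).def
    (show (0 : ℝ) < h / (2 * 32 ^ 2) by positivity)
  filter_upwards [h2, eventually_ge_atTop 1] with m hm hm1
  have hm0 : m ≠ 0 := by omega
  have hτ : (1 : ℝ) ≤ m.divisors.card := by
    exact_mod_cast Finset.card_pos.2 ⟨1, Nat.one_mem_divisors.2 hm0⟩
  have hlog : 0 ≤ Real.log m := Real.log_natCast_nonneg m
  have hφ : (0 : ℝ) < m.totient := by exact_mod_cast Nat.totient_pos.2 (by omega)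
  simp only [Function.comp_apply] at hm
  rw [Real.norm_of_nonneg (by positivity : (0 : ℝ) ≤ (m : ℝ) ^ (1 / 4 : ℝ))] at hm
  calc (m.divisors.card : ℝ) * (A * (C + (Real.log m + 2) ^ 12)) + D * Real.log m
      ≤ m.divisors.card * (A * (C + (Real.log m + 2) ^ 12) + D * Real.log m) := by
        have := le_mul_of_one_le_left (mul_nonneg hD hlog) hτ
        linarith
    _ ≤ m.divisors.card * (h / (2 * 32 ^ 2) * (m : ℝ) ^ (1 / 4 : ℝ)) := by
        gcongr
        exact (le_abs_self _).trans hm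
    _ = h / (2 * 32 ^ 2) * (m.divisors.card * (m : ℝ) ^ (1 / 4 : ℝ)) := by ring
    _ ≤ h / (2 * 32 ^ 2) * (32 ^ 2 * m.totient) := by
        exact mul_le_mul_of_nonneg_left (Nat.card_divisors_mul_rpow_le hm0) (by positivity)
    _ = m.totient * h / 2 := by ring
    _ < m.totient * h := half_lt_self (by positivity)

open Polynomial in
/-- Möbius inversion turns bounds for `z ^ d - 1` into a lower bound for `Φ_m(z)`. -/
theorem Complex.exp_mul_max_pow_totient_le_norm_cyclotomic {z : ℂ}
    (hz : ∀ n : ℕ, 0 < n → z ^ n ≠ 1) {m : ℕ} (hm : 0 < m) {B : ℝ}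
    (hB : ∀ d : ℕ, 0 < d → d ≤ m → |Real.log ‖z ^ d - 1‖ - d * Real.log (max ‖z‖ 1)| ≤ B) :
    Real.exp (-(m.divisors.card * B)) * max ‖z‖ 1 ^ m.totient ≤ ‖aeval z (cyclotomic m ℤ)‖ := by
  set L := Real.log (max ‖z‖ 1)
  set g : ℕ → ℝ := fun d => Real.log ‖aeval z (cyclotomic d ℤ)‖ - d.totient * L
  set E : ℕ → ℝ := fun d => Real.log ‖z ^ d - 1‖ - d * L
  have hprod (n : ℕ) (hn : 0 < n) : ∏ d ∈ n.divisors, aeval z (cyclotomic d ℤ) = z ^ n - 1 := by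
    rw [← map_prod, prod_cyclotomic_eq_X_pow_sub_one hn]
    simp
  have hne (n : ℕ) (hn : 0 < n) : aeval z (cyclotomic n ℤ) ≠ 0 :=
    Finset.prod_ne_zero_iff.1 (by rw [hprod n hn]; exact sub_ne_zero.2 (hz n hn)) n
      (Nat.mem_divisors_self n hn.ne')
  have hsum : ∀ n > 0, ∑ d ∈ n.divisors, g d = E n := by
    intro n hn
    simp only [g, E]
    rw [Finset.sum_sub_distrib, ← Finset.sum_mul, ← Nat.cast_sum, Nat.sum_totient,
      ← hprod n hn, norm_prod, Real.log_prod]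
    exact fun d hd => norm_ne_zero_iff.2 (hne d (Nat.pos_of_mem_divisors hd))
  have hg := (ArithmeticFunction.sum_eq_iff_sum_mul_moebius_eq.1 hsum) m hm
  have hle : |g m| ≤ m.divisors.card * B := by
    rw [← hg]
    rw [Nat.sum_divisorsAntidiagonal
      fun i j => ((ArithmeticFunction.moebius i : ℤ) : ℝ) * E j, ← nsmul_eq_mul]
    refine (Finset.abs_sum_le_sum_abs _ _).trans ?_
    refine Finset.sum_le_card_nsmul _ _ _ fun d hd => ?_
    have hd0 := Nat.pos_of_mem_divisors hd
    have hdm := Nat.le_of_dvd hm (Nat.dvd_of_mem_divisors hd)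
    have hμ : |((ArithmeticFunction.moebius d : ℤ) : ℝ)| ≤ 1 := by
      exact_mod_cast ArithmeticFunction.abs_moebius_le_one
    rw [abs_mul]
    refine (mul_le_of_le_one_left (abs_nonneg _) hμ).trans (hB _ ?_ (Nat.div_le_self _ _))
    exact Nat.div_pos hdm hd0
  have hpos := norm_pos_iff.2 (hne m hm)
  have hmax : 0 < max ‖z‖ 1 := lt_max_of_lt_right one_pos
  rw [← Real.exp_log hpos, ← Real.exp_log (pow_pos hmax _), ← Real.exp_add, Real.log_pow]
  refine Real.exp_le_exp.2 ?_
  have := (abs_le.1 hle).1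
  simp only [g] at this
  linarith

theorem Complex.abs_log_norm_one_sub_pow_le {w : ℂ} (hw : ‖w‖ < 1) {d : ℕ} (hd : 0 < d) :
    |Real.log ‖1 - w ^ d‖| ≤ -Real.log (1 - ‖w‖) + Real.log 2 := by
  have h0 : ‖w‖ ^ d ≤ ‖w‖ := pow_le_of_le_one (norm_nonneg _) hw.le hd.ne'
  have h1 : 1 - ‖w‖ ≤ ‖1 - w ^ d‖ := by
    have := norm_sub_norm_le 1 (w ^ d)
    rw [norm_one, norm_pow] at this
    linarith
  have h2 : ‖1 - w ^ d‖ ≤ 2 := by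
    have := norm_sub_le 1 (w ^ d)
    rw [norm_one, norm_pow] at this
    linarith
  have h3 : 0 < 1 - ‖w‖ := sub_pos.2 hw
  have h4 := Real.log_le_log h3 h1
  have h5 := Real.log_le_log (h3.trans_le h1) h2
  have h6 : Real.log (1 - ‖w‖) ≤ 0 := Real.log_nonpos h3.le (by linarith [norm_nonneg w])
  have h7 : 0 ≤ Real.log 2 := Real.log_nonneg (by norm_num)
  rw [abs_le]
  constructor <;> linarith

open NumberField in
theorem exists_forall_abs_log_norm_pow_sub_one_sub_le {k : Type*} [Field k] [NumberField k]
    (σ : k →+* ℂ) {δ : k} (hδ0 : δ ≠ 0) (hδ : ∀ n : ℕ, 0 < n → δ ^ n ≠ 1) :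
    ∃ (C : ℝ) (U₀ : ℕ), ∀ U ≥ U₀, ∀ d : ℕ, 0 < d → (d : ℝ) ≤ Real.exp U →
      |Real.log ‖σ δ ^ d - 1‖ - d * Real.log (max ‖σ δ‖ 1)| ≤ C + (U : ℝ) ^ 12 := by
  have hσ0 : σ δ ≠ 0 := (map_ne_zero σ).2 hδ0
  rcases lt_trichotomy ‖σ δ‖ 1 with h | h | h
  · refine ⟨-Real.log (1 - ‖σ δ‖) + Real.log 2, 0, fun U _ d hd _ => ?_⟩
    rw [max_eq_right h.le, Real.log_one, mul_zero, sub_zero, norm_sub_rev]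
    exact (Complex.abs_log_norm_one_sub_pow_le h hd).trans (le_add_of_nonneg_right (by positivity))
  · obtain ⟨U₀, hU₀⟩ := exists_forall_exp_neg_le_norm_pow_sub_one σ hδ h
    refine ⟨Real.log 2, U₀, fun U hU d hd hdU => ?_⟩
    rw [h, max_self, Real.log_one, mul_zero, sub_zero, abs_le]
    have h1 := hU₀ U hU d hd hdU
    have h2 := Real.log_le_log (Real.exp_pos _) h1
    rw [Real.log_exp] at h2
    have h3 : ‖σ δ ^ d - 1‖ ≤ 2 := by
      have := norm_sub_le (σ δ ^ d) 1
      rw [norm_one, norm_pow, h, one_pow] at this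
      linarith
    have h4 := Real.log_le_log ((Real.exp_pos _).trans_le h1) h3
    have h7 : 0 ≤ Real.log 2 := Real.log_nonneg (by norm_num)
    have h8 : (0 : ℝ) ≤ (U : ℝ) ^ 12 := by positivity
    constructor <;> linarith
  · have hw : ‖(σ δ)⁻¹‖ < 1 := by
      rw [norm_inv]
      exact inv_lt_one_of_one_lt₀ h
    refine ⟨-Real.log (1 - ‖(σ δ)⁻¹‖) + Real.log 2, 0, fun U _ d hd _ => ?_⟩
    have h1 : σ δ ^ d - 1 = σ δ ^ d * (1 - (σ δ)⁻¹ ^ d) := by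
      rw [mul_sub, ← mul_pow, mul_inv_cancel₀ hσ0, one_pow, mul_one]
    have h2 : ‖1 - (σ δ)⁻¹ ^ d‖ ≠ 0 := by
      rw [norm_ne_zero_iff]
      intro h3
      rw [h3, mul_zero] at h1
      refine hδ d hd (σ.injective ?_)
      rw [map_pow, map_one]
      exact sub_eq_zero.1 h1
    rw [max_eq_left h.le, h1, norm_mul, Real.log_mul (norm_ne_zero_iff.2 (pow_ne_zero d hσ0)) h2,
      norm_pow, Real.log_pow,
      add_sub_cancel_left]
    exact (Complex.abs_log_norm_one_sub_pow_le hw hd).trans (le_add_of_nonneg_right (by positivity))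

theorem NumberField.FinitePlace.algebraMap_lt_one_iff {k : Type*} [Field k] [NumberField k]
    (v : FinitePlace k) (x : 𝓞 k) :
    v (algebraMap (𝓞 k) k x) < 1 ↔ x ∈ v.maximalIdeal.asIdeal := by
  rw [← FinitePlace.norm_embedding_eq, FinitePlace.norm_lt_one_iff_mem]

theorem NumberField.FinitePlace.algebraMap_eq_one_iff {k : Type*} [Field k] [NumberField k]
    (v : FinitePlace k) (x : 𝓞 k) :
    v (algebraMap (𝓞 k) k x) = 1 ↔ x ∉ v.maximalIdeal.asIdeal := by
  rw [← FinitePlace.norm_embedding_eq, FinitePlace.norm_eq_one_iff_notMem]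

theorem NumberField.FinitePlace.exists_mul_eq {k : Type*} [Field k] [NumberField k]
    (v : FinitePlace k) {x : k} (hx : v x ≤ 1) :
    ∃ a b : 𝓞 k, b ∉ v.maximalIdeal.asIdeal ∧ x * algebraMap (𝓞 k) k b = algebraMap (𝓞 k) k a := by
  have h : v.maximalIdeal.valuation k x ≤ 1 := by
    rw [← FinitePlace.norm_embedding_eq, FinitePlace.norm_embedding'] at hx
    exact (WithZeroMulInt.toNNReal_le_one_iff
      (HeightOneSpectrum.one_lt_absNorm_nnreal v.maximalIdeal)).1 (by exact_mod_cast hx)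
  obtain ⟨a, b, hab⟩ := v.maximalIdeal.exists_primeCompl_mul_eq_of_integer x h
  exact ⟨a, b, b.2, hab⟩

theorem NumberField.FinitePlace.apply_le_inv_absNorm {k : Type*} [Field k] [NumberField k]
    (v : FinitePlace k) {x : k} (hx : v x < 1) :
    v x ≤ (v.maximalIdeal.asIdeal.absNorm : ℝ)⁻¹ := by
  obtain ⟨a, b, hb, hab⟩ := v.exists_mul_eq hx.le
  have h1 : v x = v (algebraMap (𝓞 k) k a) := by
    rw [← hab, map_mul, (v.algebraMap_eq_one_iff b).2 hb, mul_one]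
  have hN : 1 < v.maximalIdeal.asIdeal.absNorm := HeightOneSpectrum.one_lt_absNorm _
  rcases eq_or_ne a 0 with rfl | ha
  · rw [h1, map_zero, map_zero]
    positivity
  have hmem : a ∈ v.maximalIdeal.asIdeal := by
    rw [← v.algebraMap_lt_one_iff, ← h1]
    exact hx
  have h2 := v.apply_mul_absNorm_pow_eq_one ha
  have h3 : multiplicity v.maximalIdeal.asIdeal (Ideal.span {a}) ≠ 0 := by
    rw [multiplicity_ne_zero, Ideal.dvd_span_singleton]
    exact hmem
  rw [h1, ← one_div, le_div_iff₀ (by positivity), ← h2]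
  refine mul_le_mul_of_nonneg_left ?_ (apply_nonneg v _)
  exact le_self_pow₀ (by exact_mod_cast hN.le) h3

theorem NumberField.FinitePlace.absNorm_le_of_prime {k : Type*} [Field k] [NumberField k]
    (v : FinitePlace k) {p : ℕ} (hp : p.Prime) (hvp : v (p : k) < 1) :
    (v.maximalIdeal.asIdeal.absNorm : ℝ)⁻¹ ^ (Module.finrank ℚ k + 1) < v (p : k) ∧
      v.maximalIdeal.asIdeal.absNorm ≤ p ^ Module.finrank ℚ k := by
  set P := v.maximalIdeal.asIdeal
  have hN : 1 < P.absNorm := HeightOneSpectrum.one_lt_absNorm _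
  have hcast : algebraMap (𝓞 k) k (p : 𝓞 k) = (p : k) := map_natCast _ _
  have hp0 : (p : 𝓞 k) ≠ 0 := Nat.cast_ne_zero.2 hp.ne_zero
  have hmem : (p : 𝓞 k) ∈ P := by
    rw [← v.algebraMap_lt_one_iff, hcast]
    exact hvp
  have hspan : (Ideal.span {(p : 𝓞 k)}).absNorm = p ^ Module.finrank ℚ k := by
    rw [Ideal.absNorm_span_natCast, RingOfIntegers.rank]
  have hpos : 0 < p ^ Module.finrank ℚ k := pow_pos hp.pos _
  have hdvd : P.absNorm ∣ p ^ Module.finrank ℚ k := by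
    rw [← hspan]
    exact map_dvd _ (Ideal.dvd_span_singleton.2 hmem)
  have hpN : p ≤ P.absNorm := by
    obtain ⟨i, -, hi⟩ := (Nat.dvd_prime_pow hp).1 hdvd
    rw [hi] at hN ⊢
    exact Nat.le_self_pow (by rintro rfl; simp at hN) p
  refine ⟨?_, Nat.le_of_dvd hpos hdvd⟩
  have h2 : v (p : k) * _ = 1 := v.apply_mul_absNorm_pow_eq_one hp0
  have h4 : P.absNorm ^ multiplicity P (Ideal.span {(p : 𝓞 k)}) ≤ p ^ Module.finrank ℚ k := by
    refine Nat.le_of_dvd hpos ?_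
    rw [← hspan, ← map_pow]
    exact map_dvd _ (pow_multiplicity_dvd _ _)
  have hp1 : (1 : ℝ) < p := by exact_mod_cast hp.one_lt
  have h5 : ((p : ℝ) ^ Module.finrank ℚ k)⁻¹ ≤ v (p : k) := by
    rw [inv_le_iff_one_le_mul₀ (by positivity), ← h2]
    refine mul_le_mul_of_nonneg_left ?_ (apply_nonneg v _)
    exact_mod_cast h4
  calc (P.absNorm : ℝ)⁻¹ ^ (Module.finrank ℚ k + 1) ≤ (p : ℝ)⁻¹ ^ (Module.finrank ℚ k + 1) := by
        gcongr
    _ < (p : ℝ)⁻¹ ^ Module.finrank ℚ k :=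
        pow_lt_pow_right_of_lt_one₀ (by positivity) (inv_lt_one_of_one_lt₀ hp1) (Nat.lt_succ_self _)
    _ = ((p : ℝ) ^ Module.finrank ℚ k)⁻¹ := inv_pow _ _
    _ ≤ v (p : k) := h5

/-- A unit at a finite place has a residue class whose order governs when `δ ^ n` is close
to `1`. -/
theorem NumberField.FinitePlace.exists_residueImage {k : Type} [Field k] [NumberField k]
    (v : FinitePlace k) {δ : k} (h1 : v δ = 1) :
    ∃ c : 𝓞 k ⧸ v.maximalIdeal.asIdeal, ResidueImage v.maximalIdeal.asIdeal δ c ∧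
      0 < orderOf c ∧ orderOf c ≤ v.maximalIdeal.asIdeal.absNorm ∧
      ∀ n : ℕ, v (δ ^ n - 1) < 1 ↔ orderOf c ∣ n := by
  set P := v.maximalIdeal.asIdeal
  have hmax : P.IsMaximal := v.maximalIdeal.isMaximal
  have hprime : P.IsPrime := hmax.isPrime
  have hfin : Finite (𝓞 k ⧸ P) := Ideal.finiteQuotientOfFreeOfNeBot P v.maximalIdeal.ne_bot
  obtain ⟨a, b, hb, hab⟩ := v.exists_mul_eq h1.le
  have ha : a ∉ P := by
    rw [← v.algebraMap_eq_one_iff, ← hab, map_mul, h1, (v.algebraMap_eq_one_iff b).2 hb, one_mul]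
  have hb' : Ideal.Quotient.mk P b ≠ 0 := fun h => hb (Ideal.Quotient.eq_zero_iff_mem.1 h)
  have ha' : Ideal.Quotient.mk P a ≠ 0 := fun h => ha (Ideal.Quotient.eq_zero_iff_mem.1 h)
  obtain ⟨b', hbb'⟩ := Ideal.Quotient.exists_inv hb'
  obtain ⟨a', haa'⟩ := Ideal.Quotient.exists_inv ha'
  set A := Ideal.Quotient.mk P a
  set B := Ideal.Quotient.mk P b
  let u : (𝓞 k ⧸ P)ˣ := ⟨A * b', a' * B, by linear_combination haa' * b' * B + hbb',
    by linear_combination haa' * b' * B + hbb'⟩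
  have hu : orderOf (A * b') = orderOf u := orderOf_units (y := u)
  refine ⟨A * b', ⟨a, b, hb, hab, ?_⟩, ?_, ?_, fun n => ?_⟩
  · change A = A * b' * B
    linear_combination -A * hbb'
  · rw [hu]
    exact orderOf_pos u
  · rw [hu, Ideal.absNorm_apply, Submodule.cardQuot_apply]
    exact orderOf_le_card.trans (Nat.card_le_card_of_injective _ Units.val_injective)
  · rw [orderOf_dvd_iff_pow_eq_one]
    have h2 : (δ ^ n - 1) * algebraMap (𝓞 k) k b ^ n = algebraMap (𝓞 k) k (a ^ n - b ^ n) := by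
      rw [sub_mul, ← mul_pow, hab, map_sub, map_pow, map_pow, one_mul]
    have h3 : v (δ ^ n - 1) = v (algebraMap (𝓞 k) k (a ^ n - b ^ n)) := by
      rw [← h2, map_mul, map_pow, (v.algebraMap_eq_one_iff b).2 hb, one_pow, mul_one]
    rw [h3, v.algebraMap_lt_one_iff, ← Ideal.Quotient.eq_zero_iff_mem, map_sub, map_pow, map_pow,
      sub_eq_zero]
    change A ^ n = B ^ n ↔ (A * b') ^ n = 1
    have h4 : B ^ n * b' ^ n = 1 := by rw [← mul_pow, hbb', one_pow]
    rw [mul_pow]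
    constructor
    · intro h
      rw [h, h4]
    · intro h
      linear_combination B ^ n * h - A ^ n * h4

open Polynomial in
theorem NumberField.FinitePlace.natCast_le_cyclotomic {k : Type} [Field k] [NumberField k]
    (v : FinitePlace k) {δ : k} (hδ : ∀ n : ℕ, 0 < n → δ ^ n ≠ 1) {m : ℕ}
    (hm : (Module.finrank ℚ k + 1) ^ (2 * Module.finrank ℚ k) < m)
    (hord : ∀ c : 𝓞 k ⧸ v.maximalIdeal.asIdeal,
      ResidueImage v.maximalIdeal.asIdeal δ c →
        orderOf c ≤ v.maximalIdeal.asIdeal.absNorm → orderOf c ≠ m) (h1 : v δ = 1) :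
    v (m : k) ≤ v (aeval δ (cyclotomic m ℤ)) := by
  obtain ⟨c, hc, hc0, hcN, hcd⟩ := v.exists_residueImage h1
  have hv : IsNonarchimedean v.val := v.add_le
  have hN : (1 : ℝ) < v.maximalIdeal.asIdeal.absNorm := by
    exact_mod_cast HeightOneSpectrum.one_lt_absNorm v.maximalIdeal
  exact hv.natCast_le_cyclotomic (inv_lt_one_of_one_lt₀ hN)
    (fun x hx => v.apply_le_inv_absNorm hx) hδ h1 hc0 hcd (hord c hc hcN)
    (fun p hp hvp => ⟨(v.absNorm_le_of_prime hp hvp).1,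
      hcN.trans (v.absNorm_le_of_prime hp hvp).2⟩) hm

theorem NumberField.one_lt_mulHeight₁ {k : Type*} [Field k] [NumberField k] {δ : k} (hδ0 : δ ≠ 0)
    (hδ : ∀ n : ℕ, 0 < n → δ ^ n ≠ 1) : 1 < Height.mulHeight₁ δ := by
  refine lt_of_le_of_ne (Height.one_le_mulHeight₁ δ) fun h => ?_
  have hinj : Function.Injective fun n : ℕ => δ ^ n := by
    intro i j hij
    by_contra hne
    wlog hlt : i < j generalizing i j
    · exact this hij.symm (Ne.symm hne) (by omega)
    refine hδ (j - i) (by omega) (mul_left_cancel₀ (pow_ne_zero i hδ0) ?_)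
    rw [← pow_add, Nat.add_sub_cancel' hlt.le, mul_one]
    exact hij.symm
  refine Set.infinite_range_of_injective hinj
    ((NumberField.finite_setOfPred_mulHeight₁_le k 1).subset ?_)
  rintro _ ⟨n, rfl⟩
  change Height.mulHeight₁ (δ ^ n) ≤ 1
  rw [Height.mulHeight₁_pow, ← h, one_pow]

open Polynomial in
/-- The lower bounds for `Φ_m(δ)` at all places, multiplied together by the product formula. -/
theorem NumberField.totient_mul_log_mulHeight₁_le {k : Type*} [Field k] [NumberField k] {δ : k}
    (hδ : ∀ n : ℕ, 0 < n → δ ^ n ≠ 1) (hδ0 : δ ≠ 0) {m : ℕ} (hm : 0 < m) {B : ℝ}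
    (hfin : ∀ v : FinitePlace k,
      v (m : k) * max (v δ) 1 ^ m.totient ≤ v (aeval δ (cyclotomic m ℤ)))
    (hinf : ∀ w : InfinitePlace k,
      Real.exp (-B) * max (w δ) 1 ^ m.totient ≤ w (aeval δ (cyclotomic m ℤ))) :
    m.totient * Real.log (Height.mulHeight₁ δ) ≤
      B * Module.finrank ℚ k + Module.finrank ℚ k * Real.log m := by
  have hm0 : (m : k) ≠ 0 := Nat.cast_ne_zero.2 hm.ne'
  set Φ := aeval δ (cyclotomic m ℤ) with hΦ
  have hΦ0 : Φ ≠ 0 := by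
    intro h
    obtain ⟨R, hR⟩ := cyclotomic.dvd_X_pow_sub_one m ℤ
    have h2 := congrArg (aeval δ) hR
    simp only [map_mul, map_sub, map_pow, aeval_X, map_one] at h2
    rw [← hΦ, h, zero_mul] at h2
    exact hδ m hm (sub_eq_zero.1 h2)
  have hmax : (fun v : FinitePlace k => max (v δ) 1).HasFiniteMulSupport := by
    refine (FinitePlace.hasFiniteMulSupport hδ0).subset fun v hv => ?_
    rw [Function.mem_mulSupport] at hv ⊢
    intro h
    rw [h, max_self] at hv
    exact hv rfl
  have hpow : (fun v : FinitePlace k => max (v δ) 1 ^ m.totient).HasFiniteMulSupport := hmax.pow _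
  have h1 : ((m : ℝ) ^ Module.finrank ℚ k)⁻¹ *
      (∏ᶠ v : FinitePlace k, max (v δ) 1) ^ m.totient ≤ ∏ᶠ v : FinitePlace k, v Φ := by
    have h2 : ∏ᶠ v : FinitePlace k, v (m : k) = ((m : ℝ) ^ Module.finrank ℚ k)⁻¹ := by
      rw [FinitePlace.prod_eq_inv_abs_norm hm0, ← map_natCast (algebraMap ℚ k),
        Algebra.norm_algebraMap]
      simp
    rw [← h2, finprod_pow hmax, ← finprod_mul_distrib (FinitePlace.hasFiniteMulSupport hm0)
      hpow]
    refine finprod_le_finprod ?_ (fun v => ?_) (FinitePlace.hasFiniteMulSupport hΦ0) hfin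
    · exact (FinitePlace.hasFiniteMulSupport hm0).mul hpow
    · have := apply_nonneg v (m : k)
      positivity
  have h3 : Real.exp (-B) ^ Module.finrank ℚ k *
      (∏ w : InfinitePlace k, max (w δ) 1 ^ w.mult) ^ m.totient ≤
      ∏ w : InfinitePlace k, w Φ ^ w.mult := by
    rw [← InfinitePlace.sum_mult_eq, ← Finset.prod_pow_eq_pow_sum, ← Finset.prod_pow,
      ← Finset.prod_mul_distrib]
    refine Finset.prod_le_prod (fun w _ => by positivity) fun w _ => ?_
    rw [pow_right_comm, ← mul_pow]
    exact pow_le_pow_left₀ (by positivity) (hinf w) _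
  have h4 : Real.exp (-B) ^ Module.finrank ℚ k * ((m : ℝ) ^ Module.finrank ℚ k)⁻¹ *
      Height.mulHeight₁ δ ^ m.totient ≤ 1 := by
    rw [mulHeight₁_eq, mul_pow, mul_mul_mul_comm]
    refine le_of_le_of_eq (mul_le_mul h3 h1 ?_ (by positivity)) (prod_abs_eq_one hΦ0)
    have : 0 ≤ ∏ᶠ v : FinitePlace k, max (v δ) 1 := finprod_nonneg fun v => by positivity
    positivity
  have hH := Height.mulHeight₁_pos δ
  have hmR : (0 : ℝ) < m := Nat.cast_pos.2 hm
  have h5 := Real.log_le_log (by positivity) h4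
  rw [Real.log_mul (by positivity) (by positivity), Real.log_mul (by positivity) (by positivity),
    Real.log_pow, Real.log_inv, Real.log_pow, Real.log_pow, Real.log_exp, Real.log_one] at h5
  linarith

open Filter Polynomial in
theorem NumberField.eventually_exists_finitePlace_lt {k : Type*} [Field k] [NumberField k] {δ : k}
    (hδ0 : δ ≠ 0) (hδ : ∀ n : ℕ, 0 < n → δ ^ n ≠ 1) :
    ∀ᶠ m : ℕ in atTop, ∃ v : FinitePlace k,
      v (aeval δ (cyclotomic m ℤ)) < v (m : k) * max (v δ) 1 ^ m.totient := by
  choose C U₀ hCU using fun w : InfinitePlace k =>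
    exists_forall_abs_log_norm_pow_sub_one_sub_le w.embedding hδ0 hδ
  set C' := ∑ w, |C w|
  have hC (w : InfinitePlace k) : C w ≤ C' := (le_abs_self _).trans
    (Finset.single_le_sum (fun w _ => abs_nonneg (C w)) (Finset.mem_univ w))
  have hU (w : InfinitePlace k) : U₀ w ≤ ∑ w, U₀ w :=
    Finset.single_le_sum (fun _ _ => Nat.zero_le _) (Finset.mem_univ w)
  have hlog : Tendsto (fun m : ℕ => Real.log m) atTop atTop :=
    Real.tendsto_log_atTop.comp tendsto_natCast_atTop_atTop
  filter_upwards [eventually_gt_atTop 0, hlog.eventually_ge_atTop (∑ w, U₀ w : ℕ),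
    eventually_card_divisors_mul_log_lt_totient (Module.finrank ℚ k) C' (Module.finrank ℚ k)
      (Nat.cast_nonneg _) (Real.log_pos (one_lt_mulHeight₁ hδ0 hδ))] with m hm hmU hlt
  by_contra! hcon
  have hlog0 : 0 ≤ Real.log m := Real.log_natCast_nonneg m
  have hinf (w : InfinitePlace k) :
      Real.exp (-(m.divisors.card * (C' + (Real.log m + 2) ^ 12))) * max (w δ) 1 ^ m.totient ≤
        w (aeval δ (cyclotomic m ℤ)) := by
    have hz (n : ℕ) (hn : 0 < n) : w.embedding δ ^ n ≠ 1 := by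
      rw [← map_pow, Ne, map_eq_one_iff _ w.embedding.injective]
      exact hδ n hn
    have h1 := Complex.exp_mul_max_pow_totient_le_norm_cyclotomic hz hm
      (B := C' + (Real.log m + 2) ^ 12) fun d hd hdm => by
        refine (hCU w ⌈Real.log m⌉₊ ?_ d hd ?_).trans (add_le_add (hC w) ?_)
        · exact (hU w).trans (by exact_mod_cast hmU.trans (Nat.le_ceil _))
        · rw [← Real.log_le_iff_le_exp (by positivity)]
          exact (Real.log_le_log (by positivity) (by exact_mod_cast hdm)).trans (Nat.le_ceil _)
        · have := Nat.ceil_lt_add_one hlog0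
          gcongr
          linarith
    have h2 : aeval (w.embedding δ) (cyclotomic m ℤ) =
        w.embedding (aeval δ (cyclotomic m ℤ)) := by
      simp only [aeval_def, hom_eval₂]
      congr 1
      exact RingHom.ext_int _ _
    rwa [h2, InfinitePlace.norm_embedding_eq, InfinitePlace.norm_embedding_eq] at h1
  have h3 := totient_mul_log_mulHeight₁_le hδ hδ0 hm hcon hinf
  linarith

/-- Let `k` be a number field and `δ` a non-zero element of `k` that is not a root of
unity.  Let `S` be a finite set of non-zero prime ideals of `𝓞 k`.  Then there is a
positive integer `n` such that for every `m ≥ n` there is a non-zero prime ideal `𝔭`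
of `𝓞 k` outside `S` such that `δ` lies in the valuation ring at `𝔭` and the
multiplicative order of the image of `δ` in the residue class field `𝓞 k ⧸ 𝔭`
is equal to `m`. -/
theorem order_in_residue_field (k : Type) [Field k] [NumberField k]
    (δ : k) (hδ0 : δ ≠ 0) (hδru : ∀ n : ℕ, 0 < n → δ ^ n ≠ 1)
    (S : Finset (Ideal (𝓞 k))) (hS : ∀ 𝔭 ∈ S, 𝔭.IsPrime ∧ 𝔭 ≠ ⊥) :
    ∃ n : ℕ, 0 < n ∧ ∀ m : ℕ, n ≤ m →
      ∃ 𝔭 : Ideal (𝓞 k), 𝔭.IsPrime ∧ 𝔭 ≠ ⊥ ∧ 𝔭 ∉ S ∧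
        ∃ c : (𝓞 k) ⧸ 𝔭, ResidueImage 𝔭 δ c ∧ orderOf c = m := by
  obtain ⟨n₀, hn₀⟩ := Filter.eventually_atTop.1 (eventually_exists_finitePlace_lt hδ0 hδru)
  refine ⟨n₀ + (Module.finrank ℚ k + 1) ^ (2 * Module.finrank ℚ k) +
    ∑ 𝔭 ∈ S, 𝔭.absNorm + 2, by omega, fun m hm => ?_⟩
  obtain ⟨v, hv⟩ := hn₀ m (by omega)
  have hval : IsNonarchimedean v.val := v.add_le
  obtain ⟨h1, hlt⟩ : v δ = 1 ∧
      v (Polynomial.aeval δ (Polynomial.cyclotomic m ℤ)) < v (m : k) := by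
    by_contra! hcon
    exact hv.not_ge (hval.natCast_mul_max_pow_le_cyclotomic (by omega) hcon)
  obtain ⟨c, hc, hcN, hcm⟩ : ∃ c, ResidueImage v.maximalIdeal.asIdeal δ c ∧
      orderOf c ≤ v.maximalIdeal.asIdeal.absNorm ∧ orderOf c = m := by
    by_contra! hcon
    exact hlt.not_ge (v.natCast_le_cyclotomic hδru (by omega) hcon h1)
  refine ⟨v.maximalIdeal.asIdeal, v.maximalIdeal.isPrime, v.maximalIdeal.ne_bot, fun hvS => ?_,
    c, hc, hcm⟩
  have hle : v.maximalIdeal.asIdeal.absNorm ≤ ∑ 𝔭 ∈ S, 𝔭.absNorm :=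
    Finset.single_le_sum (f := fun 𝔭 : Ideal (𝓞 k) => 𝔭.absNorm) (fun _ _ => Nat.zero_le _) hvS
  omega
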